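/- There is a primitive recursive function h with the following property: for every oracle A ∈ ℕ^ℕ and every index e, one can find, effectively in e, an A'-recursive treemap H: T_e^{A'} → T_{h(e)}^A which induces a homeomorphism of P_e^{A'} onto P_{h(e)}^A, and such that X ⊕ A' ≡_T H(X) ⊕ A' ≡_T (H(X) ⊕ A)' uniformly for all X ∈ P_e^{A'}. -/

import Mathlib

namespace Harrington

open scoped Classical

/-- Codes for oracle Turing machines (partial recursive functionals),
    extending `Nat.Partrec.Code` with an `oracle` constructor. -/
inductive OCode : Type
  | zero : OCode
  | succ : OCode
  | left : OCode
  | right : OCode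
  | oracle : OCode
  | pair : OCode → OCode → OCode
  | comp : OCode → OCode → OCode
  | prec : OCode → OCode → OCode
  | rfind' : OCode → OCode

/-- Evaluation of an oracle code relative to a (total) oracle `A`. -/
def evalo (A : ℕ → ℕ) : OCode → ℕ →. ℕ
  | OCode.zero => pure 0
  | OCode.succ => fun n => Part.some (n + 1)
  | OCode.left => fun n => Part.some (Nat.unpair n).1
  | OCode.right => fun n => Part.some (Nat.unpair n).2
  | OCode.oracle => fun n => Part.some (A n)
  | OCode.pair cf cg => fun n => Nat.pair <$> evalo A cf n <*> evalo A cg n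
  | OCode.comp cf cg => fun n => evalo A cg n >>= evalo A cf
  | OCode.prec cf cg =>
    Nat.unpaired fun a n =>
      n.rec (evalo A cf a) fun y IH => do
        let i ← IH
        evalo A cg (Nat.pair a (Nat.pair y i))
  | OCode.rfind' cf =>
    Nat.unpaired fun a m =>
      (Nat.rfind fun n => (fun x => x = 0) <$> evalo A cf (Nat.pair a (n + m))).map (· + m)

/-- The standard enumeration of oracle codes: `OCode.ofNat e` is the `e`-th oracle machine. -/
def OCode.ofNat : ℕ → OCode
  | 0 => OCode.zero
  | 1 => OCode.succ
  | 2 => OCode.left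
  | 3 => OCode.right
  | 4 => OCode.oracle
  | n + 5 =>
    have hm : n.div2.div2 < n + 5 := by
      have h1 : n.div2.div2 ≤ n := by
        simp only [Nat.div2_val]
        exact le_trans (Nat.div_le_self _ _) (Nat.div_le_self _ _)
      omega
    have _m1 : n.div2.div2.unpair.1 < n + 5 := lt_of_le_of_lt (Nat.unpair_left_le _) hm
    have _m2 : n.div2.div2.unpair.2 < n + 5 := lt_of_le_of_lt (Nat.unpair_right_le _) hm
    match n.bodd, n.div2.bodd with
    | false, false => OCode.pair (OCode.ofNat n.div2.div2.unpair.1) (OCode.ofNat n.div2.div2.unpair.2)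
    | false, true  => OCode.comp (OCode.ofNat n.div2.div2.unpair.1) (OCode.ofNat n.div2.div2.unpair.2)
    | true,  false => OCode.prec (OCode.ofNat n.div2.div2.unpair.1) (OCode.ofNat n.div2.div2.unpair.2)
    | true,  true  => OCode.rfind' (OCode.ofNat n.div2.div2)

/-- The Turing jump `A'` of an oracle `A`:  `A'(e) = 1` if the `e`-th machine with
    oracle `A` halts on input `e`, and `A'(e) = 0` otherwise. -/
noncomputable def jump (A : ℕ → ℕ) : ℕ → ℕ :=
  fun e => if (evalo A (OCode.ofNat e) e).Dom then 1 else 0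

/-- Iterated Turing jump `A^{(n)}`. -/
noncomputable def jumpIter (A : ℕ → ℕ) : ℕ → (ℕ → ℕ)
  | 0 => A
  | n + 1 => jump (jumpIter A n)

/-- The constant zero function (the trivial oracle `0`). -/
def zeroF : ℕ → ℕ := fun _ => 0

/-- The `ω`-jump: `X^{(ω)} = {(i,n) : i ∈ X^{(n)}}`, coded via `Nat.pair` and identified
    with its characteristic function. -/
noncomputable def omegaJump (A : ℕ → ℕ) : ℕ → ℕ :=
  fun m => if jumpIter A m.unpair.2 m.unpair.1 ≠ 0 then 1 else 0

/-- The recursive join `A ⊕ B`. -/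
def oplus (A B : ℕ → ℕ) : ℕ → ℕ :=
  fun n => if n % 2 = 0 then A (n / 2) else B (n / 2)

/-- Code `c` computes the total function `f` from oracle `A`. -/
def computesFn (A : ℕ → ℕ) (c : OCode) (f : ℕ → ℕ) : Prop :=
  ∀ n, evalo A c n = Part.some (f n)

/-- Turing reducibility `X ≤_T A` for points of Baire space. -/
def TRedIn (X A : ℕ → ℕ) : Prop := ∃ c : OCode, computesFn A c X

/-- `X` is arithmetical relative to `Y`: `X ≤_T Y^{(n)}` for some `n`. -/
def ArithIn (X Y : ℕ → ℕ) : Prop := ∃ n : ℕ, TRedIn X (jumpIter Y n)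

/-- `X` and `Y` are arithmetically equivalent. -/
def ArithEquiv (X Y : ℕ → ℕ) : Prop := ArithIn X Y ∧ ArithIn Y X

/-! ### Strings and trees -/

/-- Strings: finite sequences of natural numbers. -/
abbrev Str := List ℕ

/-- The initial segment `X↾n` of a point `X` of Baire space. -/
def initSeg (X : ℕ → ℕ) (n : ℕ) : Str := (List.range n).map X

/-- A tree is a set of strings closed under initial segments. -/
def IsTree (T : Set Str) : Prop := ∀ σ τ : Str, σ <+: τ → τ ∈ T → σ ∈ T

/-- `[T]`, the set of paths through `T`. -/
def paths (T : Set Str) : Set (ℕ → ℕ) := {X | ∀ n, initSeg X n ∈ T}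

/-- The characteristic function of a set of strings. -/
noncomputable def chi (T : Set Str) : Str → ℕ := fun σ => if σ ∈ T then 1 else 0

/-- A set of strings is `A`-recursive: its characteristic function is computable from `A`. -/
def SetRecIn (A : ℕ → ℕ) (T : Set Str) : Prop :=
  ∃ c : OCode, ∀ σ : Str, evalo A c (Encodable.encode σ) = Part.some (chi T σ)

/-- `P ⊆ ℕ^ℕ` is `Π^{0,A}_1` : `P = [T]` for some `A`-recursive tree `T`. -/
def IsPi01In (A : ℕ → ℕ) (P : Set (ℕ → ℕ)) : Prop :=
  ∃ T : Set Str, IsTree T ∧ SetRecIn A T ∧ P = paths T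

/-- `P ⊆ ℕ^ℕ` is `Π⁰₁` : `P = [T]` for some recursive tree `T`. -/
def IsPi01 (P : Set (ℕ → ℕ)) : Prop := IsPi01In zeroF P

/-! ### Treemaps -/

/-- `F` is a treemap on the tree `T`: `F(σ⌢⟨i⟩) ⊇ F(σ)⌢⟨i⟩` whenever `σ⌢⟨i⟩ ∈ T`. -/
def IsTreemapOn (T : Set Str) (F : Str → Str) : Prop :=
  ∀ (σ : Str) (i : ℕ), σ ++ [i] ∈ T → (F σ) ++ [i] <+: F (σ ++ [i])

/-- The image tree `F(T) = {τ : ∃ σ ∈ T, τ ⊆ F(σ)}`. -/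
def treeImage (F : Str → Str) (T : Set Str) : Set Str :=
  {τ | ∃ σ ∈ T, τ <+: F σ}

/-- The map on paths induced by a treemap: `X ↦ ⋃ₙ F(X↾n)`. -/
def pathMap (F : Str → Str) (X : ℕ → ℕ) : ℕ → ℕ :=
  fun i => (F (initSeg X (i + 1))).getD i 0

/-- The string function `F` is `A`-recursive on `T` (restriction of a partial
    `A`-recursive function). -/
def FnRecInOn (A : ℕ → ℕ) (F : Str → Str) (T : Set Str) : Prop :=
  ∃ c : OCode, ∀ σ ∈ T, evalo A c (Encodable.encode σ) = Part.some (Encodable.encode (F σ))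

/-- `F` maps `P` homeomorphically onto `Q` (subspace topologies from Baire space). -/
def HomeoOn (F : (ℕ → ℕ) → (ℕ → ℕ)) (P Q : Set (ℕ → ℕ)) : Prop :=
  Set.BijOn F P Q ∧ ContinuousOn F P ∧
    ∃ G : (ℕ → ℕ) → (ℕ → ℕ), Set.InvOn G F P Q ∧ ContinuousOn G Q

/-- `f X ≡_T g X` uniformly for all `X ∈ P`: the Turing reductions are given by
    fixed indices independent of `X`. -/
def UnifEquivOn (P : Set (ℕ → ℕ)) (f g : (ℕ → ℕ) → (ℕ → ℕ)) : Prop :=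
  ∃ c d : OCode, ∀ X ∈ P, computesFn (g X) c (f X) ∧ computesFn (f X) d (g X)

/-! ### Standard enumerations -/

/-- `W_e^A`: the `e`-th `A`-recursively enumerable set of strings. -/
def WA (A : ℕ → ℕ) (e : ℕ) : Set Str :=
  {σ | (evalo A (OCode.ofNat e) (Encodable.encode σ)).Dom}

/-- `T_e^A = {σ : ∀ n ≤ |σ|, σ↾n ∉ W_e^A}`: the standard enumeration of `Π^{0,A}_1` trees. -/
def TA (A : ℕ → ℕ) (e : ℕ) : Set Str :=
  {σ | ∀ n ≤ σ.length, σ.take n ∉ WA A e}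

/-- `P_e^A = [T_e^A]`: the standard enumeration of `Π^{0,A}_1` subsets of Baire space. -/
def PA (A : ℕ → ℕ) (e : ℕ) : Set (ℕ → ℕ) := paths (TA A e)

/-! ### The arithmetical hierarchy on Baire space -/

/-- Prepend a number to a point of Baire space. -/
def consF (k : ℕ) (X : ℕ → ℕ) : ℕ → ℕ := fun i => Nat.casesOn i k fun j => X j

/-- `Σ⁰ₙ` subsets of Baire space.  `Σ⁰₀` sets are the recursive clopen sets
    (depending computably on a fixed finite initial segment), and
    `Σ⁰ₙ₊₁` sets are obtained from `Π⁰ₙ` sets by existential number quantification. -/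
def SigmaN : ℕ → Set (ℕ → ℕ) → Prop
  | 0, P => ∃ (k : ℕ) (f : Str → Bool), Computable f ∧ P = {X | f (initSeg X k) = true}
  | n + 1, P => ∃ Q : Set (ℕ → ℕ), SigmaN n Qᶜ ∧ P = {X | ∃ k : ℕ, consF k X ∈ Q}

/-- `Π⁰ₙ` subsets of Baire space: complements of `Σ⁰ₙ` sets. -/
def PiN (n : ℕ) (P : Set (ℕ → ℕ)) : Prop := SigmaN n Pᶜ

/-- Arithmetical subsets of Baire space: `Π⁰ₙ` for some `n`. -/
def IsArith (P : Set (ℕ → ℕ)) : Prop := ∃ n : ℕ, PiN n P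


/-! ### Indices of oracle codes -/

namespace OCode

/-- The index of the composition of two codes given by their indices. -/
def compIdx (i j : ℕ) : ℕ := 2 * (2 * Nat.pair i j + 1) + 5

/-- The index of the pairing of two codes given by their indices. -/
def pairIdx (i j : ℕ) : ℕ := 2 * (2 * Nat.pair i j) + 5

/-- The index of a code for the constant function with value `n`. -/
def constIdx : ℕ → ℕ
  | 0 => 0
  | n + 1 => compIdx 1 (constIdx n)

theorem ofNat_compIdx (i j : ℕ) : ofNat (compIdx i j) = comp (ofNat i) (ofNat j) := by
  rw [compIdx, ofNat]
  simp [Nat.div2_val]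

theorem ofNat_pairIdx (i j : ℕ) : ofNat (pairIdx i j) = pair (ofNat i) (ofNat j) := by
  rw [pairIdx, ofNat]
  simp [Nat.div2_val]

theorem ofNat_surjective : Function.Surjective ofNat := by
  intro c
  induction c with
  | zero => exact ⟨0, by rw [ofNat]⟩
  | succ => exact ⟨1, by rw [ofNat]⟩
  | left => exact ⟨2, by rw [ofNat]⟩
  | right => exact ⟨3, by rw [ofNat]⟩
  | oracle => exact ⟨4, by rw [ofNat]⟩
  | pair a b ha hb =>
    obtain ⟨i, rfl⟩ := ha
    obtain ⟨j, rfl⟩ := hb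
    exact ⟨_, ofNat_pairIdx i j⟩
  | comp a b ha hb =>
    obtain ⟨i, rfl⟩ := ha
    obtain ⟨j, rfl⟩ := hb
    exact ⟨_, ofNat_compIdx i j⟩
  | prec a b ha hb =>
    obtain ⟨i, rfl⟩ := ha
    obtain ⟨j, rfl⟩ := hb
    exact ⟨(2 * (2 * Nat.pair i j) + 1) + 5, by rw [ofNat]; simp [Nat.div2_val]⟩
  | rfind' a ha =>
    obtain ⟨i, rfl⟩ := ha
    exact ⟨(2 * (2 * i + 1) + 1) + 5, by rw [ofNat]; simp [Nat.div2_val]⟩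

theorem primrec₂_compIdx : Primrec₂ compIdx := by
  have h := Primrec₂.natPair.comp (Primrec.fst (α := ℕ) (β := ℕ)) Primrec.snd
  exact Primrec.nat_add.comp (Primrec.nat_mul.comp (Primrec.const 2)
    (Primrec.succ.comp (Primrec.nat_mul.comp (Primrec.const 2) h))) (Primrec.const 5)

theorem primrec₂_pairIdx : Primrec₂ pairIdx := by
  have h := Primrec₂.natPair.comp (Primrec.fst (α := ℕ) (β := ℕ)) Primrec.snd
  exact Primrec.nat_add.comp (Primrec.nat_mul.comp (Primrec.const 2)
    (Primrec.nat_mul.comp (Primrec.const 2) h)) (Primrec.const 5)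

theorem primrec_constIdx : Primrec constIdx := by
  refine (Primrec.nat_rec₁ 0 (primrec₂_compIdx.comp (Primrec.const 1) Primrec.snd).to₂).of_eq
    fun n => ?_
  induction n with
  | zero => rfl
  | succ n ih => simp only [constIdx, ih]

theorem evalo_constIdx (A : ℕ → ℕ) (m n : ℕ) :
    evalo A (ofNat (constIdx m)) n = Part.some m := by
  induction m with
  | zero => simp [constIdx, ofNat, evalo, pure, PFun.pure]
  | succ m ih => simp [constIdx, ofNat_compIdx, evalo, ih, ofNat]

theorem evalo_pair_left_right (A : ℕ → ℕ) (n : ℕ) :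
    evalo A (pair left right) n = Part.some n := by
  simp [evalo, Seq.seq]

/-- The s-m-n theorem for oracle codes. -/
theorem exists_primrec_curry (c : OCode) : ∃ f : ℕ → ℕ, Nat.Primrec f ∧
    ∀ (A : ℕ → ℕ) (m n : ℕ), evalo A (ofNat (f m)) n = evalo A c (Nat.pair m n) := by
  obtain ⟨i, rfl⟩ := ofNat_surjective c
  obtain ⟨j, hj⟩ := ofNat_surjective (pair left right)
  refine ⟨fun m => compIdx i (pairIdx (constIdx m) j), Primrec.nat_iff.1
    (primrec₂_compIdx.comp (Primrec.const i)
      (primrec₂_pairIdx.comp primrec_constIdx (Primrec.const j))), fun A m n => ?_⟩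
  have h : evalo A (ofNat j) n = Part.some n := by rw [hj, evalo_pair_left_right]
  simp only [ofNat_compIdx, ofNat_pairIdx, evalo, evalo_constIdx, h, Seq.seq, Part.map_eq_map,
    Part.map_some, Part.bind_some]
  exact Part.bind_some _ _

/-- Replacing oracle calls by calls to a code. -/
def subst (d : OCode) : OCode → OCode
  | zero => zero
  | succ => succ
  | left => left
  | right => right
  | oracle => d
  | pair a b => pair (subst d a) (subst d b)
  | comp a b => comp (subst d a) (subst d b)
  | prec a b => prec (subst d a) (subst d b)
  | rfind' a => rfind' (subst d a)

theorem evalo_subst {A B : ℕ → ℕ} {d : OCode} (h : computesFn B d A) (c : OCode) :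
    evalo B (subst d c) = evalo A c := by
  induction c with
  | oracle => funext n; simp [subst, evalo, h n]
  | pair a b ha hb | comp a b ha hb | prec a b ha hb => simp only [subst, evalo, ha, hb]; rfl
  | rfind' a ha => simp only [subst, evalo, ha]; rfl
  | _ => rfl

theorem exists_of_partrec {f : ℕ →. ℕ} (hf : Nat.Partrec f) :
    ∃ c : OCode, ∀ A, evalo A c = f := by
  induction hf with
  | zero => exact ⟨zero, fun A => rfl⟩
  | succ => exact ⟨succ, fun A => rfl⟩
  | left => exact ⟨left, fun A => rfl⟩
  | right => exact ⟨right, fun A => rfl⟩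
  | pair _ _ hf hg =>
    obtain ⟨c, hc⟩ := hf
    obtain ⟨d, hd⟩ := hg
    exact ⟨pair c d, fun A => by rw [evalo, hc, hd]⟩
  | comp _ _ hf hg =>
    obtain ⟨c, hc⟩ := hf
    obtain ⟨d, hd⟩ := hg
    exact ⟨comp c d, fun A => by rw [evalo, hc, hd]⟩
  | prec _ _ hf hg =>
    obtain ⟨c, hc⟩ := hf
    obtain ⟨d, hd⟩ := hg
    exact ⟨prec c d, fun A => by rw [evalo, hc, hd]⟩
  | rfind _ hf =>
    obtain ⟨c, hc⟩ := hf
    refine ⟨comp (rfind' c) (pair (pair left right) zero), fun A => ?_⟩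
    funext n
    simp only [evalo, hc, Seq.seq, pure, PFun.pure]
    simp only [Part.map_eq_map, Part.map_some, Part.bind_eq_bind, Part.bind_some, Nat.unpaired,
      Nat.pair_unpair, Nat.unpair_pair, Nat.add_zero]
    exact Part.map_id' (fun _ => rfl) _

end OCode

/-! ### Evaluation with bounded fuel and a finite part of the oracle -/

namespace OCode

/-- Evaluation of a code with recursion depth at most `k`, where the oracle is only known on the
arguments below the length of the list `L` of its values. -/
def evaln : ℕ → List ℕ → OCode → ℕ → Option ℕ
  | 0, _, _, _ => none
  | k + 1, L, c, n =>
    match c with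
    | zero => some 0
    | succ => some (n + 1)
    | left => some n.unpair.1
    | right => some n.unpair.2
    | oracle => L[n]?
    | pair a b => (evaln k L a n).bind fun x => (evaln k L b n).map (Nat.pair x)
    | comp a b => (evaln k L b n).bind fun x => evaln k L a x
    | prec a b =>
      if n.unpair.2 = 0 then evaln k L a n.unpair.1
      else (evaln k L (prec a b) (Nat.pair n.unpair.1 (n.unpair.2 - 1))).bind fun i =>
        evaln k L b (Nat.pair n.unpair.1 (Nat.pair (n.unpair.2 - 1) i))
    | rfind' a => (evaln k L a n).bind fun x =>
      if x = 0 then some n.unpair.2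
      else evaln k L (rfind' a) (Nat.pair n.unpair.1 (n.unpair.2 + 1))

theorem evaln_mono {k k' : ℕ} {L L' : List ℕ} (hk : k ≤ k') (hL : L <+: L') {c : OCode}
    {n x : ℕ} (h : evaln k L c n = some x) : evaln k' L' c n = some x := by
  induction k generalizing k' c n x with
  | zero => simp [evaln] at h
  | succ k ih =>
    obtain ⟨k', rfl⟩ : ∃ j, k' = j + 1 := ⟨k' - 1, by omega⟩
    have ih := fun {c n x} => ih (k' := k') (by omega) (c := c) (n := n) (x := x)
    cases c with
    | oracle =>
      obtain ⟨R, rfl⟩ := hL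
      simp only [evaln] at h ⊢
      rw [List.getElem?_append_left (List.getElem?_eq_some_iff.1 h).1, h]
    | pair a b =>
      simp only [evaln, Option.bind_eq_some_iff, Option.map_eq_some_iff] at h ⊢
      obtain ⟨u, hu, v, hv, rfl⟩ := h
      exact ⟨u, ih hu, v, ih hv, rfl⟩
    | comp a b =>
      simp only [evaln, Option.bind_eq_some_iff] at h ⊢
      obtain ⟨u, hu, hv⟩ := h
      exact ⟨u, ih hu, ih hv⟩
    | prec a b =>
      simp only [evaln] at h ⊢
      split_ifs at h ⊢
      · exact ih h
      · simp only [Option.bind_eq_some_iff] at h ⊢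
        obtain ⟨u, hu, hv⟩ := h
        exact ⟨u, ih hu, ih hv⟩
    | rfind' a =>
      simp only [evaln, Option.bind_eq_some_iff] at h ⊢
      obtain ⟨u, hu, hv⟩ := h
      refine ⟨u, ih hu, ?_⟩
      split_ifs at hv ⊢
      · exact hv
      · exact ih hv
    | _ => exact h

theorem mem_evalo_pair {A : ℕ → ℕ} {a b : OCode} {n z : ℕ} :
    z ∈ evalo A (pair a b) n ↔ ∃ x ∈ evalo A a n, ∃ y ∈ evalo A b n, z = Nat.pair x y := by
  simp only [evalo, Seq.seq, Part.map_eq_map, Part.mem_bind_iff, Part.mem_map_iff]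
  constructor
  · rintro ⟨_, ⟨x, hx, rfl⟩, y, hy, rfl⟩
    exact ⟨x, hx, y, hy, rfl⟩
  · rintro ⟨x, hx, y, hy, rfl⟩
    exact ⟨_, ⟨x, hx, rfl⟩, y, hy, rfl⟩

theorem mem_evalo_comp {A : ℕ → ℕ} {a b : OCode} {n z : ℕ} :
    z ∈ evalo A (comp a b) n ↔ ∃ x ∈ evalo A b n, z ∈ evalo A a x := by
  simp only [evalo]
  exact Part.mem_bind_iff

theorem mem_evalo_prec_zero {A : ℕ → ℕ} {a b : OCode} {n z : ℕ} :
    z ∈ evalo A (prec a b) (Nat.pair n 0) ↔ z ∈ evalo A a n := by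
  simp [evalo]

theorem mem_evalo_prec_succ {A : ℕ → ℕ} {a b : OCode} {n m z : ℕ} :
    z ∈ evalo A (prec a b) (Nat.pair n (m + 1)) ↔
      ∃ i ∈ evalo A (prec a b) (Nat.pair n m), z ∈ evalo A b (Nat.pair n (Nat.pair m i)) := by
  simp [evalo]

theorem mem_evalo_rfind' {A : ℕ → ℕ} {a : OCode} {n m z : ℕ} :
    z ∈ evalo A (rfind' a) (Nat.pair n m) ↔
      ∃ d, z = d + m ∧ 0 ∈ evalo A a (Nat.pair n (d + m)) ∧
        ∀ i < d, ∃ x ∈ evalo A a (Nat.pair n (i + m)), x ≠ 0 := by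
  simp only [evalo, Nat.unpaired, Nat.unpair_pair, Part.map_eq_map]
  refine (Part.mem_map_iff _).trans ⟨?_, ?_⟩
  · rintro ⟨d, hd, rfl⟩
    obtain ⟨h0, h1⟩ := Nat.mem_rfind.1 hd
    exact ⟨d, rfl, by simpa using h0, fun i hi => by simpa using h1 hi⟩
  · rintro ⟨d, rfl, h0, h1⟩
    exact ⟨d, Nat.mem_rfind.2 ⟨by simpa using h0, fun {i} hi => by simpa using h1 i hi⟩, rfl⟩

theorem evaln_sound {A : ℕ → ℕ} {j k : ℕ} {c : OCode} {n x : ℕ}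
    (h : evaln k (initSeg A j) c n = some x) : x ∈ evalo A c n := by
  induction k generalizing c n x with
  | zero => simp [evaln] at h
  | succ k ih =>
    cases c with
    | oracle =>
      simp only [evaln, initSeg, List.getElem?_map, Option.map_eq_some_iff] at h
      obtain ⟨y, hy, rfl⟩ := h
      obtain ⟨_, rfl⟩ := List.getElem?_eq_some_iff.1 hy
      simp [evalo]
    | pair a b =>
      simp only [evaln, Option.bind_eq_some_iff, Option.map_eq_some_iff] at h
      obtain ⟨u, hu, v, hv, rfl⟩ := h
      exact mem_evalo_pair.2 ⟨u, ih hu, v, ih hv, rfl⟩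
    | comp a b =>
      simp only [evaln, Option.bind_eq_some_iff] at h
      obtain ⟨u, hu, hv⟩ := h
      exact mem_evalo_comp.2 ⟨u, ih hu, ih hv⟩
    | prec a b =>
      obtain ⟨n, m, rfl⟩ : ∃ p q, n = Nat.pair p q := ⟨_, _, (Nat.pair_unpair n).symm⟩
      simp only [evaln, Nat.unpair_pair] at h
      cases m with
      | zero => exact mem_evalo_prec_zero.2 (ih (by simpa using h))
      | succ m =>
        simp only [Nat.add_eq_zero_iff, one_ne_zero, and_false, if_false, Nat.add_sub_cancel,
          Option.bind_eq_some_iff] at h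
        obtain ⟨u, hu, hv⟩ := h
        exact mem_evalo_prec_succ.2 ⟨u, ih hu, ih hv⟩
    | rfind' a =>
      obtain ⟨n, m, rfl⟩ : ∃ p q, n = Nat.pair p q := ⟨_, _, (Nat.pair_unpair n).symm⟩
      simp only [evaln, Nat.unpair_pair, Option.bind_eq_some_iff] at h
      obtain ⟨u, hu, hv⟩ := h
      split_ifs at hv with h0
      · subst h0
        obtain rfl := Option.some.inj hv
        exact mem_evalo_rfind'.2 ⟨0, by simp, by simpa using ih hu, by simp⟩
      · obtain ⟨d, rfl, hd, hlt⟩ := mem_evalo_rfind'.1 (ih hv)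
        refine mem_evalo_rfind'.2 ⟨d + 1, by ring, by convert hd using 2; ring_nf, ?_⟩
        rintro (_ | i) hi
        · exact ⟨u, by simpa using ih hu, h0⟩
        · obtain ⟨y, hy, hy0⟩ := hlt i (by omega)
          exact ⟨y, by convert hy using 2; ring_nf, hy0⟩
    | _ => simp_all [evaln, evalo, pure, PFun.pure]

theorem initSeg_prefix (X : ℕ → ℕ) {m n : ℕ} (h : m ≤ n) : initSeg X m <+: initSeg X n := by
  obtain ⟨d, rfl⟩ := Nat.exists_eq_add_of_le h
  exact ⟨_, by rw [initSeg, initSeg, List.range_add, List.map_append]⟩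

theorem evaln_complete {A : ℕ → ℕ} {c : OCode} {n x : ℕ} (h : x ∈ evalo A c n) :
    ∃ k, evaln k (initSeg A k) c n = some x := by
  have mono {k k' : ℕ} (hk : k ≤ k') {c : OCode} {n x : ℕ}
      (h : evaln k (initSeg A k) c n = some x) : evaln k' (initSeg A (k' + 1)) c n = some x :=
    evaln_mono hk (initSeg_prefix A (by omega)) h
  induction c generalizing n x with
  | oracle =>
    refine ⟨n + 1, ?_⟩
    simp_all [evaln, evalo, initSeg]
  | pair a b iha ihb =>
    obtain ⟨u, hu, v, hv, rfl⟩ := mem_evalo_pair.1 h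
    obtain ⟨k₁, hk₁⟩ := iha hu
    obtain ⟨k₂, hk₂⟩ := ihb hv
    refine ⟨max k₁ k₂ + 1, ?_⟩
    simp [evaln, mono (le_max_left k₁ k₂) hk₁, mono (le_max_right k₁ k₂) hk₂]
  | comp a b iha ihb =>
    obtain ⟨u, hu, hv⟩ := mem_evalo_comp.1 h
    obtain ⟨k₁, hk₁⟩ := ihb hu
    obtain ⟨k₂, hk₂⟩ := iha hv
    refine ⟨max k₁ k₂ + 1, ?_⟩
    simp [evaln, mono (le_max_left k₁ k₂) hk₁, mono (le_max_right k₁ k₂) hk₂]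
  | prec a b iha ihb =>
    obtain ⟨n, m, rfl⟩ : ∃ p q, n = Nat.pair p q := ⟨_, _, (Nat.pair_unpair n).symm⟩
    induction m generalizing x with
    | zero =>
      obtain ⟨k, hk⟩ := iha (mem_evalo_prec_zero.1 h)
      exact ⟨k + 1, by simpa [evaln] using mono le_rfl hk⟩
    | succ m ihm =>
      obtain ⟨u, hu, hv⟩ := mem_evalo_prec_succ.1 h
      obtain ⟨k₁, hk₁⟩ := ihm hu
      obtain ⟨k₂, hk₂⟩ := ihb hv
      refine ⟨max k₁ k₂ + 1, ?_⟩
      simp [evaln, mono (le_max_left k₁ k₂) hk₁, mono (le_max_right k₁ k₂) hk₂]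
  | rfind' a iha =>
    obtain ⟨n, m, rfl⟩ : ∃ p q, n = Nat.pair p q := ⟨_, _, (Nat.pair_unpair n).symm⟩
    obtain ⟨d, rfl, h0, h1⟩ := mem_evalo_rfind'.1 h
    clear h
    induction d generalizing m with
    | zero =>
      obtain ⟨k, hk⟩ := iha h0
      rw [Nat.zero_add] at hk
      exact ⟨k + 1, by simp [evaln, mono le_rfl hk]⟩
    | succ d ihd =>
      obtain ⟨u, hu, hu0⟩ := h1 0 (by omega)
      rw [Nat.zero_add] at hu
      obtain ⟨k₁, hk₁⟩ := iha hu
      have e : ∀ i, i + 1 + m = i + (m + 1) := fun i => by ring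
      obtain ⟨k₂, hk₂⟩ := ihd (m + 1) (by rw [← e]; exact h0)
        (fun i hi => by rw [← e]; exact h1 (i + 1) (by omega))
      refine ⟨max k₁ k₂ + 1, ?_⟩
      rw [e]
      simp [evaln, mono (le_max_left k₁ k₂) hk₁, mono (le_max_right k₁ k₂) hk₂, hu0]
  | _ =>
    refine ⟨1, ?_⟩
    simp_all [evaln, evalo, pure, PFun.pure]

end OCode

/-! ### Computability of bounded evaluation -/

namespace OCode

/-- The first recursive call made by the machine of index `m + 5`. -/
def firstCall (e n : ℕ) : ℕ × ℕ :=
  bif (e - 5).bodd then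
    bif (e - 5).div2.bodd then ((e - 5).div2.div2, n)
    else bif n.unpair.2 == 0 then ((e - 5).div2.div2.unpair.1, n.unpair.1)
    else (e, Nat.pair n.unpair.1 (n.unpair.2 - 1))
  else
    bif (e - 5).div2.bodd then ((e - 5).div2.div2.unpair.2, n)
    else ((e - 5).div2.div2.unpair.1, n)

/-- The second recursive call, if any, made by the machine of index `m + 5` when the first one
returned `x`. -/
def secondCall (e n x : ℕ) : Option (ℕ × ℕ) :=
  bif (e - 5).bodd then
    bif (e - 5).div2.bodd then
      bif x == 0 then none else some (e, Nat.pair n.unpair.1 (n.unpair.2 + 1))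
    else bif n.unpair.2 == 0 then none
    else some ((e - 5).div2.div2.unpair.2, Nat.pair n.unpair.1 (Nat.pair (n.unpair.2 - 1) x))
  else
    bif (e - 5).div2.bodd then some ((e - 5).div2.div2.unpair.1, x)
    else some ((e - 5).div2.div2.unpair.2, n)

/-- The value returned when there is no second recursive call. -/
def firstValue (e n x : ℕ) : ℕ := bif (e - 5).div2.bodd then n.unpair.2 else x

/-- The value returned when the second recursive call returns `y`. -/
def secondValue (e x y : ℕ) : ℕ :=
  bif (e - 5).bodd then y else bif (e - 5).div2.bodd then y else Nat.pair x y

/-- The value of the basic machines, of index less than `5`. -/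
def basicValue (L : List ℕ) (e n : ℕ) : Option ℕ :=
  bif e == 0 then some 0 else bif e == 1 then some (n + 1) else bif e == 2 then some n.unpair.1
  else bif e == 3 then some n.unpair.2 else L[n]?

theorem evaln_basic (k : ℕ) (L : List ℕ) {e : ℕ} (he : e < 5) (n : ℕ) :
    evaln (k + 1) L (ofNat e) n = basicValue L e n := by
  interval_cases e <;> simp [basicValue, ofNat, evaln]

theorem evaln_compound (k : ℕ) (L : List ℕ) {e : ℕ} (he : ¬ e < 5) (n : ℕ) :
    evaln (k + 1) L (ofNat e) n =
      (evaln k L (ofNat (firstCall e n).1) (firstCall e n).2).bind fun x =>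
        match secondCall e n x with
        | none => some (firstValue e n x)
        | some q => (evaln k L (ofNat q.1) q.2).map (secondValue e x) := by
  obtain ⟨m, rfl⟩ : ∃ m, e = m + 5 := ⟨e - 5, by omega⟩
  have h : ofNat (m + 5) = _ := ofNat.eq_6 m
  have hs : secondValue (m + 5) = fun x y =>
      bif m.bodd then y else bif m.div2.bodd then y else Nat.pair x y := by
    funext x y
    simp [secondValue]
  rcases h0 : m.bodd <;> rcases h1 : m.div2.bodd <;> simp only [h0, h1, cond] at h hs
  · simp [h, evaln, firstCall, secondCall, hs, h0, h1]
  · simp [h, evaln, firstCall, secondCall, hs, h0, h1]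
  · by_cases hn : n.unpair.2 = 0
    · rw [h]
      simp [evaln, firstCall, secondCall, firstValue, h0, h1, hn]
    · have hb : (n.unpair.2 == 0) = false := by simpa using hn
      conv_lhs => rw [h]
      simp only [evaln, if_neg hn, ← h]
      simp [firstCall, secondCall, hs, h0, h1, hb]
  · conv_lhs => rw [h]
    simp only [evaln, ← h]
    simp only [firstCall, secondCall, firstValue, hs, Nat.add_sub_cancel, h0, h1, cond_true]
    congr 1
    funext x
    by_cases hx : x = 0
    · simp [hx]
    · have hb : (x == 0) = false := by simpa using hx
      simp [hx, hb]

section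

theorem primrec_argument : Primrec fun e : ℕ => (e - 5).div2.div2 :=
  Primrec.nat_div2.comp (Primrec.nat_div2.comp (Primrec.nat_sub.comp Primrec.id (Primrec.const 5)))

theorem primrec_bodd_sub_five : Primrec fun e : ℕ => (e - 5).bodd :=
  Primrec.nat_bodd.comp (Primrec.nat_sub.comp Primrec.id (Primrec.const 5))

theorem primrec_bodd_div2_sub_five : Primrec fun e : ℕ => (e - 5).div2.bodd :=
  Primrec.nat_bodd.comp (Primrec.nat_div2.comp (Primrec.nat_sub.comp Primrec.id (Primrec.const 5)))

theorem primrec_isZero {α : Type*} [Primcodable α] {f : α → ℕ} (hf : Primrec f) (m : ℕ) :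
    Primrec fun a => f a == m :=
  Primrec.beq.comp hf (Primrec.const m)

theorem primrec_unpair_fst {α : Type*} [Primcodable α] {f : α → ℕ} (hf : Primrec f) :
    Primrec fun a => (f a).unpair.1 := Primrec.fst.comp (Primrec.unpair.comp hf)

theorem primrec_unpair_snd {α : Type*} [Primcodable α] {f : α → ℕ} (hf : Primrec f) :
    Primrec fun a => (f a).unpair.2 := Primrec.snd.comp (Primrec.unpair.comp hf)

theorem primrec_firstCall : Primrec fun p : ℕ × ℕ => firstCall p.1 p.2 := by
  have e : Primrec fun p : ℕ × ℕ => p.1 := Primrec.fst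
  have n : Primrec fun p : ℕ × ℕ => p.2 := Primrec.snd
  have m := primrec_argument.comp e
  refine Primrec.cond (primrec_bodd_sub_five.comp e) (Primrec.cond (primrec_bodd_div2_sub_five.comp e) (m.pair n) ?_) ?_
  · exact Primrec.cond (primrec_isZero (primrec_unpair_snd n) 0)
      ((primrec_unpair_fst m).pair (primrec_unpair_fst n))
      (e.pair (Primrec₂.natPair.comp (primrec_unpair_fst n)
        (Primrec.nat_sub.comp (primrec_unpair_snd n) (Primrec.const 1))))
  · exact Primrec.cond (primrec_bodd_div2_sub_five.comp e) ((primrec_unpair_snd m).pair n)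
      ((primrec_unpair_fst m).pair n)

theorem primrec_secondCall : Primrec fun p : (ℕ × ℕ) × ℕ => secondCall p.1.1 p.1.2 p.2 := by
  have e : Primrec fun p : (ℕ × ℕ) × ℕ => p.1.1 := Primrec.fst.comp Primrec.fst
  have n : Primrec fun p : (ℕ × ℕ) × ℕ => p.1.2 := Primrec.snd.comp Primrec.fst
  have x : Primrec fun p : (ℕ × ℕ) × ℕ => p.2 := Primrec.snd
  have m := primrec_argument.comp e
  refine Primrec.cond (primrec_bodd_sub_five.comp e) (Primrec.cond (primrec_bodd_div2_sub_five.comp e) ?_ ?_)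
    (Primrec.cond (primrec_bodd_div2_sub_five.comp e) ?_ ?_)
  · exact Primrec.cond (primrec_isZero x 0) (Primrec.const none)
      (Primrec.option_some.comp (e.pair (Primrec₂.natPair.comp (primrec_unpair_fst n)
        (Primrec.succ.comp (primrec_unpair_snd n)))))
  · exact Primrec.cond (primrec_isZero (primrec_unpair_snd n) 0) (Primrec.const none)
      (Primrec.option_some.comp ((primrec_unpair_snd m).pair
        (Primrec₂.natPair.comp (primrec_unpair_fst n) (Primrec₂.natPair.comp
          (Primrec.nat_sub.comp (primrec_unpair_snd n) (Primrec.const 1)) x))))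
  · exact Primrec.option_some.comp ((primrec_unpair_fst m).pair x)
  · exact Primrec.option_some.comp ((primrec_unpair_snd m).pair n)

theorem primrec_firstValue : Primrec fun p : (ℕ × ℕ) × ℕ => firstValue p.1.1 p.1.2 p.2 :=
  Primrec.cond (primrec_bodd_div2_sub_five.comp (Primrec.fst.comp Primrec.fst))
    (primrec_unpair_snd (Primrec.snd.comp Primrec.fst)) Primrec.snd

theorem primrec_secondValue : Primrec fun p : (ℕ × ℕ) × ℕ => secondValue p.1.1 p.1.2 p.2 :=
  Primrec.cond (primrec_bodd_sub_five.comp (Primrec.fst.comp Primrec.fst)) Primrec.snd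
    (Primrec.cond (primrec_bodd_div2_sub_five.comp (Primrec.fst.comp Primrec.fst)) Primrec.snd
      (Primrec₂.natPair.comp (Primrec.snd.comp Primrec.fst) Primrec.snd))

theorem primrec_basicValue : Primrec fun p : List ℕ × ℕ × ℕ => basicValue p.1 p.2.1 p.2.2 := by
  have e : Primrec fun p : List ℕ × ℕ × ℕ => p.2.1 := Primrec.fst.comp Primrec.snd
  have n : Primrec fun p : List ℕ × ℕ × ℕ => p.2.2 := Primrec.snd.comp Primrec.snd
  refine Primrec.cond (primrec_isZero e 0) (Primrec.const _)
    (Primrec.cond (primrec_isZero e 1) (Primrec.option_some.comp (Primrec.succ.comp n))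
    (Primrec.cond (primrec_isZero e 2) (Primrec.option_some.comp (primrec_unpair_fst n))
    (Primrec.cond (primrec_isZero e 3) (Primrec.option_some.comp (primrec_unpair_snd n))
      (Primrec.list_getElem?.comp Primrec.fst n))))

end

end OCode

namespace OCode

section

open Nat.Partrec (Code)
open Encodable

/-- One level of recursion of `evaln`, where deeper levels are computed by the code `c`. -/
def evalStep (c : Code) (v : ℕ × List ℕ × ℕ × ℕ) : Part ℕ :=
  Nat.casesOn v.1 (Part.some 0) fun k =>
    bif decide (v.2.2.1 < 5) then Part.some (encode (basicValue v.2.1 v.2.2.1 v.2.2.2))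
    else (c.eval (encode (k, v.2.1, firstCall v.2.2.1 v.2.2.2))).bind fun r =>
      Nat.casesOn r (Part.some 0) fun x =>
        Option.casesOn (secondCall v.2.2.1 v.2.2.2 x)
          (Part.some (firstValue v.2.2.1 v.2.2.2 x + 1)) fun q =>
          (c.eval (encode (k, v.2.1, q))).bind fun r' =>
            Nat.casesOn r' (Part.some 0) fun y => Part.some (secondValue v.2.2.1 x y + 1)

theorem partrec_evalStep : Partrec₂ evalStep := by
  refine Partrec.nat_casesOn_right (Computable.fst.comp Computable.snd) (Computable.const 0) ?_
  refine Partrec.cond (Primrec.nat_lt.decide.comp (Primrec.fst.comp (Primrec.snd.comp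
    (Primrec.snd.comp (Primrec.snd.comp Primrec.fst)))) (Primrec.const 5)).to_comp ?_ ?_
  · exact (Primrec.encode.comp (primrec_basicValue.comp
      (Primrec.snd.comp (Primrec.snd.comp Primrec.fst)))).to_comp.partrec
  · refine Partrec.bind (Code.eval_part.comp (Computable.fst.comp Computable.fst) ?_) ?_
    · exact (Primrec.encode.comp (Primrec.snd.pair ((Primrec.fst.comp
        (Primrec.snd.comp (Primrec.snd.comp Primrec.fst))).pair (primrec_firstCall.comp
        (Primrec.snd.comp (Primrec.snd.comp (Primrec.snd.comp Primrec.fst))))))).to_comp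
    refine Partrec.nat_casesOn_right Computable.snd (Computable.const 0) ?_
    have en : Primrec fun p : ((((Code × (ℕ × List ℕ × ℕ × ℕ)) × ℕ) × ℕ) × ℕ) =>
        p.1.1.1.2.2.2 := Primrec.snd.comp (Primrec.snd.comp (Primrec.snd.comp
          (Primrec.fst.comp (Primrec.fst.comp Primrec.fst))))
    refine Partrec.optionCasesOn_right (primrec_secondCall.comp (en.pair Primrec.snd)).to_comp
      (Primrec.succ.comp (primrec_firstValue.comp (en.pair Primrec.snd))).to_comp ?_
    refine Partrec.bind (Code.eval_part.comp (Computable.fst.comp (Computable.fst.comp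
      (Computable.fst.comp (Computable.fst.comp Computable.fst)))) ?_) ?_
    · exact (Primrec.encode.comp ((Primrec.snd.comp (Primrec.fst.comp (Primrec.fst.comp
        Primrec.fst))).pair ((Primrec.fst.comp (Primrec.snd.comp (Primrec.snd.comp
        (Primrec.fst.comp (Primrec.fst.comp (Primrec.fst.comp Primrec.fst)))))).pair
        Primrec.snd))).to_comp
    · refine Partrec.nat_casesOn_right Computable.snd (Computable.const 0) ?_
      exact (Primrec.succ.comp (primrec_secondValue.comp (((Primrec.fst.comp en).comp
        (Primrec.fst.comp (Primrec.fst.comp Primrec.fst))  |>.pair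
        (Primrec.snd.comp (Primrec.fst.comp (Primrec.fst.comp Primrec.fst)))).pair
        Primrec.snd))).to_comp.partrec

theorem computable_evaln : Computable fun v : ℕ × List ℕ × ℕ × ℕ =>
    evaln v.1 v.2.1 (ofNat v.2.2.1) v.2.2.2 := by
  have hd : Computable fun v : ℕ =>
      (decode v : Option (ℕ × List ℕ × ℕ × ℕ)).getD (0, [], 0, 0) :=
    Computable.option_getD Computable.decode (Computable.const _)
  have hp : Partrec₂ fun (c : Code) (v : ℕ) =>
      evalStep c ((decode v : Option (ℕ × List ℕ × ℕ × ℕ)).getD (0, [], 0, 0)) :=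
    partrec_evalStep.comp Computable.fst (hd.comp Computable.snd)
  obtain ⟨c, hc⟩ := Code.fixed_point₂ hp
  have key (k : ℕ) : ∀ (L : List ℕ) (e n : ℕ), c.eval (encode (k, L, e, n)) =
      Part.some (encode (evaln k L (ofNat e) n)) := by
    induction k with
    | zero =>
      intro L e n
      simp only [hc, encodek, Option.getD_some]
      rfl
    | succ k ih =>
      intro L e n
      simp only [hc, encodek, Option.getD_some]
      simp only [evalStep]
      by_cases he : e < 5
      · simp [he, evaln_basic]
      · rw [evaln_compound _ _ he, ih]
        simp only [he, decide_false, cond_false, Part.bind_some]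
        rcases evaln k L (ofNat (firstCall e n).1) (firstCall e n).2 with _ | x
        · rfl
        · simp only [Option.bind_some, encode_some, encode_nat]
          rcases secondCall e n x with _ | q
          · rfl
          · simp only [ih, Part.bind_some]
            rcases evaln k L (ofNat q.1) q.2 with _ | y <;> rfl
  have h : Computable fun v : ℕ × List ℕ × ℕ × ℕ =>
      encode (evaln v.1 v.2.1 (ofNat v.2.2.1) v.2.2.2) :=
    ((Code.eval_part.comp (Computable.const c) Computable.encode).of_eq fun v => by
      obtain ⟨k, L, e, n⟩ := v
      exact key k L e n)
  exact (Computable.encode_iff.1 h)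

end

/-- Does the machine of index `e` halt on `n` in at most `L.length` steps, using only the part of
the oracle listed in `L`? -/
def sim (L : List ℕ) (e n : ℕ) : Bool := (evaln L.length L (ofNat e) n).isSome

theorem computable_sim : Computable fun v : List ℕ × ℕ × ℕ => sim v.1 v.2.1 v.2.2 :=
  Primrec.option_isSome.to_comp.comp (computable_evaln.comp
    ((Computable.list_length.comp Computable.fst).pair Computable.id))

theorem sim_mono {L L' : List ℕ} (h : L <+: L') {e n : ℕ} (hs : sim L e n = true) :
    sim L' e n = true := by
  obtain ⟨x, hx⟩ := Option.isSome_iff_exists.1 hs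
  exact Option.isSome_iff_exists.2 ⟨x, evaln_mono h.length_le h hx⟩

@[simp]
theorem length_initSeg (X : ℕ → ℕ) (n : ℕ) : (initSeg X n).length = n := by simp [initSeg]

theorem dom_iff_sim {A : ℕ → ℕ} {e n : ℕ} :
    (evalo A (ofNat e) n).Dom ↔ ∃ k, sim (initSeg A k) e n = true := by
  simp only [sim, length_initSeg]
  constructor
  · intro h
    obtain ⟨k, hk⟩ := evaln_complete (Part.get_mem h)
    exact ⟨k, by rw [hk]; rfl⟩
  · rintro ⟨k, hk⟩
    obtain ⟨x, hx⟩ := Option.isSome_iff_exists.1 hk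
    exact Part.dom_iff_mem.2 ⟨x, evaln_sound hx⟩

end OCode

/-! ### Uniform relative computability -/

section

open Encodable OCode

/-- The values `y i` are computed from the arguments `x i` with oracle `S i`, by a machine that
does not depend on `i`. -/
def UComp {ι α β : Type*} [Primcodable α] [Primcodable β] (S : ι → ℕ → ℕ) (x : ι → α)
    (y : ι → β) : Prop :=
  ∃ c : OCode, ∀ i, evalo (S i) c (encode (x i)) = Part.some (encode (y i))

/-- The functions `T i` are computed with oracle `S i`, by a machine that does not depend on
`i`. -/
def URed {ι : Type*} (S T : ι → ℕ → ℕ) : Prop := ∃ c : OCode, ∀ i, computesFn (S i) c (T i)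

namespace UComp

variable {ι κ α β γ : Type*} [Primcodable α] [Primcodable β] [Primcodable γ]
  {S : ι → ℕ → ℕ} {x : ι → α}

theorem of_computable {f : α → β} (hf : Computable f) : UComp S x fun i => f (x i) := by
  obtain ⟨c, hc⟩ := exists_of_partrec hf
  exact ⟨c, fun i => by simp [hc]⟩

theorem congr {y z : ι → β} (h : UComp S x y) (hyz : ∀ i, y i = z i) : UComp S x z := by
  rwa [← funext hyz]

theorem trans {y : ι → β} {z : ι → γ} (h : UComp S x y) (h' : UComp S y z) : UComp S x z := by
  obtain ⟨c, hc⟩ := h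
  obtain ⟨d, hd⟩ := h'
  refine ⟨comp d c, fun i => ?_⟩
  rw [evalo]
  exact (congrArg (fun p => Part.bind p (evalo (S i) d)) (hc i)).trans
    ((Part.bind_some _ _).trans (hd i))

theorem map {y : ι → β} (h : UComp S x y) {f : β → γ} (hf : Computable f) :
    UComp S x fun i => f (y i) :=
  h.trans (of_computable hf)

theorem pair {y : ι → β} {z : ι → γ} (h : UComp S x y) (h' : UComp S x z) :
    UComp S x fun i => (y i, z i) := by
  obtain ⟨c, hc⟩ := h
  obtain ⟨d, hd⟩ := h'
  refine ⟨OCode.pair c d, fun i => ?_⟩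
  simp [evalo, Seq.seq, hc, hd]

theorem map₂ {δ : Type*} [Primcodable δ] {y : ι → β} {z : ι → γ} (h : UComp S x y)
    (h' : UComp S x z) {f : β → γ → δ} (hf : Computable₂ f) : UComp S x fun i => f (y i) (z i) :=
  (h.pair h').map hf

theorem reindex {y : ι → β} (h : UComp S x y) (f : κ → ι) :
    UComp (fun k => S (f k)) (fun k => x (f k)) (fun k => y (f k)) := by
  obtain ⟨c, hc⟩ := h
  exact ⟨c, fun k => hc (f k)⟩

theorem oracle {n : ι → ℕ} (h : UComp S x n) : UComp S x fun i => S i (n i) :=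
  h.trans ⟨OCode.oracle, fun _ => rfl⟩

theorem nat_rec {f : ι → ℕ → β} (h0 : UComp S x fun i => f i 0)
    (hs : UComp (fun p : ι × ℕ => S p.1) (fun p => (x p.1, p.2, f p.1 p.2))
      fun p => f p.1 (p.2 + 1)) :
    UComp (fun p : ι × ℕ => S p.1) (fun p => (x p.1, p.2)) fun p => f p.1 p.2 := by
  obtain ⟨c, hc⟩ := h0
  obtain ⟨d, hd⟩ := hs
  refine ⟨prec c d, fun ⟨i, n⟩ => ?_⟩
  refine Part.eq_some_iff.2 ?_
  simp only [encode_prod_val, encode_nat]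
  induction n with
  | zero => exact mem_evalo_prec_zero.2 (Part.eq_some_iff.1 (hc i))
  | succ n ih => exact mem_evalo_prec_succ.2 ⟨_, ih, Part.eq_some_iff.1 (hd (i, n))⟩

theorem exists_mem_iff {p : ι → ℕ → Bool}
    (hp : UComp (fun q : ι × ℕ => S q.1) (fun q => (x q.1, q.2)) fun q => p q.1 q.2) :
    ∃ c : OCode, ∀ i z, z ∈ evalo (S i) c (encode (x i)) ↔
      p i z = true ∧ ∀ j < z, p i j = false := by
  have hn : Computable fun b : Bool => cond b 0 1 :=
    Computable.cond Computable.id (Computable.const 0) (Computable.const 1)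
  obtain ⟨c, hc⟩ := hp.map hn
  refine ⟨comp (rfind' c) (OCode.pair (OCode.pair left right) zero), fun i z => ?_⟩
  have h (k : ℕ) : evalo (S i) c (Nat.pair (encode (x i)) k) = Part.some (cond (p i k) 0 1) :=
    hc (i, k)
  rw [mem_evalo_comp]
  have h' : evalo (S i) (OCode.pair (OCode.pair left right) zero) (encode (x i)) =
      Part.some (Nat.pair (encode (x i)) 0) := by
    simp [evalo, Seq.seq, pure, PFun.pure]
  simp only [h', Part.mem_some_iff, exists_eq_left, mem_evalo_rfind', h, Nat.add_zero]
  constructor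
  · rintro ⟨d, rfl, h0, h1⟩
    refine ⟨by_contra fun hz => by simp [hz] at h0, fun j hj => ?_⟩
    exact Bool.eq_false_iff.2 fun hz => h1 j hj (by simp [hz])
  · rintro ⟨h0, h1⟩
    exact ⟨z, rfl, by simp [h0], fun j hj => by simp [h1 j hj]⟩

theorem sInf_of_exists {p : ι → ℕ → Bool}
    (hp : UComp (fun q : ι × ℕ => S q.1) (fun q => (x q.1, q.2)) fun q => p q.1 q.2)
    (hex : ∀ i, ∃ n, p i n = true) : UComp S x fun i => sInf {n | p i n = true} := by
  obtain ⟨c, hc⟩ := hp.exists_mem_iff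
  refine ⟨c, fun i => Part.eq_some_iff.2 ((hc i _).2 ⟨Nat.sInf_mem (hex i), fun j hj => ?_⟩)⟩
  exact Bool.eq_false_iff.2 (Nat.notMem_of_lt_sInf hj)

theorem exists_dom_iff {p : ι → ℕ → Bool}
    (hp : UComp (fun q : ι × ℕ => S q.1) (fun q => (x q.1, q.2)) fun q => p q.1 q.2) :
    ∃ c : OCode, ∀ i, (evalo (S i) c (encode (x i))).Dom ↔ ∃ n, p i n = true := by
  obtain ⟨c, hc⟩ := hp.exists_mem_iff
  refine ⟨c, fun i => Part.dom_iff_mem.trans ⟨fun ⟨z, hz⟩ => ⟨z, ((hc i z).1 hz).1⟩, fun h => ?_⟩⟩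
  refine ⟨_, (hc i _).2 ⟨Nat.sInf_mem h, fun j hj => ?_⟩⟩
  exact Bool.eq_false_iff.2 (Nat.notMem_of_lt_sInf hj)

theorem trans_uRed {T : ι → ℕ → ℕ} {y : ι → β} (h : UComp T x y) (hT : URed S T) :
    UComp S x y := by
  obtain ⟨c, hc⟩ := h
  obtain ⟨d, hd⟩ := hT
  exact ⟨subst d c, fun i => by rw [evalo_subst (hd i), hc i]⟩

theorem extend {y : ι → β} (h : UComp S x y) :
    UComp (fun q : ι × γ => S q.1) (fun q => (x q.1, q.2)) fun q => y q.1 :=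
  (of_computable Computable.fst).trans (h.reindex Prod.fst)

end UComp

theorem computable_half : Computable fun n : ℕ => n / 2 :=
  (Primrec.nat_div.comp Primrec.id (Primrec.const 2)).to_comp

theorem UComp.oplus {ι α : Type*} [Primcodable α] {S T U : ι → ℕ → ℕ} {x : ι → α} {n : ι → ℕ}
    (h : UComp S x fun i => T i (n i / 2)) (h' : UComp S x fun i => U i (n i / 2))
    (hn : UComp S x n) : UComp S x fun i => oplus (T i) (U i) (n i) := by
  have hm : Computable fun p : ℕ × ℕ × ℕ => cond (p.1 % 2 == 0) p.2.1 p.2.2 :=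
    (Primrec.cond (Primrec.beq.comp (Primrec.nat_mod.comp Primrec.fst (Primrec.const 2))
      (Primrec.const 0)) (Primrec.fst.comp Primrec.snd) (Primrec.snd.comp Primrec.snd)).to_comp
  refine ((hn.pair (h.pair h')).map hm).congr fun i => ?_
  rw [Harrington.oplus]
  by_cases hp : n i % 2 = 0
  · simp [hp]
  · rw [beq_false_of_ne hp, if_neg hp, cond_false]

theorem initSeg_succ (X : ℕ → ℕ) (n : ℕ) : initSeg X (n + 1) = initSeg X n ++ [X n] := by
  simp [initSeg, List.range_succ]

theorem UComp.initSeg {ι α : Type*} [Primcodable α] {S T : ι → ℕ → ℕ} {x : ι → α} {n : ι → ℕ}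
    (hT : UComp (fun p : ι × ℕ => S p.1) (fun p => (x p.1, p.2)) fun p => T p.1 p.2)
    (hn : UComp S x n) : UComp S x fun i => initSeg (T i) (n i) := by
  have h : UComp (fun p : ι × ℕ => S p.1) (fun p => (x p.1, p.2))
      fun p => Harrington.initSeg (T p.1) p.2 := by
    refine UComp.nat_rec (f := fun i => Harrington.initSeg (T i))
      (UComp.of_computable (Computable.const ([] : List ℕ))) ?_
    simp only [initSeg_succ]
    refine UComp.map₂ (f := fun (l : List ℕ) a => l ++ [a])
      (UComp.of_computable (Computable.snd.comp Computable.snd)) ?_ Computable.list_concat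
    exact (UComp.of_computable (Computable.fst.pair (Computable.fst.comp Computable.snd))).trans hT
  exact ((UComp.of_computable Computable.id).pair hn).trans (h.reindex fun i => (i, n i))

namespace URed

variable {ι : Type*} {S T U : ι → ℕ → ℕ}

theorem iff_uComp : URed S T ↔
    UComp (fun p : ι × ℕ => S p.1) (fun p => p.2) fun p => T p.1 p.2 :=
  ⟨fun ⟨c, hc⟩ => ⟨c, fun p => hc p.1 p.2⟩, fun ⟨c, hc⟩ => ⟨c, fun i n => hc (i, n)⟩⟩

theorem trans (h : URed S T) (h' : URed T U) : URed S U := by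
  rw [iff_uComp] at h' ⊢
  obtain ⟨c, hc⟩ := h
  exact h'.trans_uRed ⟨c, fun p => hc p.1⟩

theorem reindex {κ : Type*} (h : URed S T) (f : κ → ι) :
    URed (fun k => S (f k)) fun k => T (f k) := by
  obtain ⟨c, hc⟩ := h
  exact ⟨c, fun k => hc (f k)⟩

theorem uComp {α : Type*} [Primcodable α] {x : ι → α} {n : ι → ℕ} (h : URed S T)
    (hn : UComp S x n) : UComp S x fun i => T i (n i) :=
  hn.trans ((iff_uComp.1 h).reindex fun i => (i, n i))

theorem left_oplus (S T : ι → ℕ → ℕ) : URed (fun i => oplus (S i) (T i)) S := by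
  have h : Computable fun n : ℕ => 2 * n :=
    (Primrec.nat_mul.comp (Primrec.const 2) Primrec.id).to_comp
  refine iff_uComp.2 (((UComp.of_computable h).oracle).trans ⟨OCode.pair left right, fun p => ?_⟩)
  rw [evalo_pair_left_right]
  simp [oplus]

theorem right_oplus (S T : ι → ℕ → ℕ) : URed (fun i => oplus (S i) (T i)) T := by
  have h : Computable fun n : ℕ => 2 * n + 1 :=
    (Primrec.succ.comp (Primrec.nat_mul.comp (Primrec.const 2) Primrec.id)).to_comp
  refine iff_uComp.2 (((UComp.of_computable h).oracle).trans ⟨OCode.pair left right, fun p => ?_⟩)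
  rw [evalo_pair_left_right]
  simp [oplus, Nat.add_mod, show (2 * p.2 + 1) / 2 = p.2 by omega]

theorem oplus (h : URed S T) (h' : URed S U) : URed S fun i => oplus (T i) (U i) := by
  refine iff_uComp.2 (UComp.oplus (T := fun p : ι × ℕ => T p.1) (U := fun p : ι × ℕ => U p.1)
    ?_ ?_ (UComp.of_computable Computable.id))
  · exact (h.reindex (Prod.fst : ι × ℕ → ι)).uComp (UComp.of_computable computable_half)
  · exact (h'.reindex (Prod.fst : ι × ℕ → ι)).uComp (UComp.of_computable computable_half)

end URed

theorem UComp.decide_exists {ι α : Type*} [Primcodable α] {S : ι → ℕ → ℕ} {x : ι → α}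
    {p : ι → ℕ → Bool}
    (hp : UComp (fun q : ι × ℕ => S q.1) (fun q => (x q.1, q.2)) fun q => p q.1 q.2) :
    UComp (fun i => jump (S i)) x fun i => decide (∃ n, p i n = true) := by
  obtain ⟨c, hc⟩ := hp.exists_dom_iff
  obtain ⟨f, hf, hfc⟩ := exists_primrec_curry (comp c left)
  have h1 : Computable fun a : α => f (encode a) :=
    (Primrec.nat_iff.2 hf).to_comp.comp Computable.encode
  have h2 : Computable fun n : ℕ => n == 1 :=
    (Primrec.beq.comp Primrec.id (Primrec.const 1)).to_comp
  refine ((UComp.of_computable h1).oracle.map h2).congr fun i => ?_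
  have h3 : (evalo (S i) (OCode.ofNat (f (encode (x i)))) (f (encode (x i)))).Dom ↔
      ∃ n, p i n = true := by
    rw [← hc i, hfc, Part.dom_iff_mem, Part.dom_iff_mem]
    simp only [mem_evalo_comp]
    simp [evalo]
  simp only [jump, h3]
  by_cases h : ∃ n, p i n = true <;> simp [h]

namespace URed

variable {ι : Type*} {S T : ι → ℕ → ℕ}

theorem jump_self (S : ι → ℕ → ℕ) : URed (fun i => jump (S i)) S := by
  refine iff_uComp.2 ?_
  have h : UComp (fun q : ((ι × ℕ) × ℕ) × ℕ => S q.1.1.1) (fun q => ((q.1.1.2, q.1.2), q.2))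
      fun q => S q.1.1.1 q.1.1.2 == q.1.2 :=
    (UComp.of_computable (Computable.fst.comp Computable.fst)).oracle.map₂
      (UComp.of_computable (Computable.snd.comp Computable.fst)) Primrec.beq.to_comp
  have h' := h.decide_exists (p := fun (q : (ι × ℕ) × ℕ) _ => S q.1.1 q.1.2 == q.2)
    (x := fun q => (q.1.2, q.2)) (S := fun q => S q.1.1)
  refine (h'.sInf_of_exists (x := fun q : ι × ℕ => q.2)
    (p := fun (q : ι × ℕ) n => decide (∃ _ : ℕ, (S q.1 q.2 == n) = true))
    (S := fun q => jump (S q.1)) fun q => ⟨S q.1 q.2, by simp⟩).congr fun q => ?_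
  simp

theorem jump_mono (h : URed S T) : URed (fun i => jump (S i)) fun i => jump (T i) := by
  refine iff_uComp.2 ?_
  have h1 : UComp (fun q : (ι × ℕ) × ℕ => S q.1.1) (fun q => (q.1.2, q.2))
      fun q => sim (initSeg (T q.1.1) q.2) q.1.2 q.1.2 := by
    have h2 : Computable fun v : ℕ × List ℕ => sim v.2 v.1 v.1 :=
      computable_sim.comp (Computable.snd.pair (Computable.fst.pair Computable.fst))
    refine ((UComp.of_computable Computable.fst).pair (UComp.initSeg ?_ ?_)).map h2
    · exact (h.reindex fun q : ((ι × ℕ) × ℕ) × ℕ => q.1.1.1).uComp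
        (UComp.of_computable Computable.snd)
    · exact UComp.of_computable Computable.snd
  have h3 : Computable fun b : Bool => cond b 1 0 :=
    Computable.cond Computable.id (Computable.const 1) (Computable.const 0)
  refine ((h1.decide_exists (x := fun q : ι × ℕ => q.2) (S := fun q => S q.1)
    (p := fun (q : ι × ℕ) n => sim (initSeg (T q.1) n) q.2 q.2)).map h3).congr fun q => ?_
  simp only [jump, dom_iff_sim]
  by_cases h : ∃ k, sim (initSeg (T q.1) k) q.2 q.2 = true <;> simp [h]

end URed

/-! ### Initial segments -/

theorem initSeg_eq_initSeg_iff {X Y : ℕ → ℕ} {n : ℕ} :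
    initSeg X n = initSeg Y n ↔ ∀ j < n, X j = Y j := by
  simp [initSeg]

theorem getD_initSeg (X : ℕ → ℕ) {n i : ℕ} (h : i < n) : (initSeg X n).getD i 0 = X i := by
  simp [initSeg, h]

theorem take_initSeg (X : ℕ → ℕ) (m n : ℕ) : (initSeg X n).take m = initSeg X (min m n) := by
  simp [initSeg, ← List.map_take, List.take_range]

theorem initSeg_length_of_prefix {X : ℕ → ℕ} {τ : Str} {n : ℕ} (h : τ <+: initSeg X n) :
    initSeg X τ.length = τ := by
  have hl := h.length_le
  rw [length_initSeg] at hl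
  conv_rhs => rw [List.prefix_iff_eq_take.1 h, take_initSeg, min_eq_left hl]

theorem initSeg_getD_of_prefix {τ τ' : Str} (h : τ <+: τ') :
    initSeg (fun j => τ'.getD j 0) τ.length = τ := by
  obtain ⟨ρ, rfl⟩ := h
  refine List.ext_getElem (by simp) fun i h1 h2 => ?_
  simp [initSeg, List.getElem?_append_left h2, h2]

theorem initSeg_getD (τ : Str) : initSeg (fun j => τ.getD j 0) τ.length = τ :=
  initSeg_getD_of_prefix List.prefix_rfl

theorem prefix_initSeg {X : ℕ → ℕ} {τ : Str} {n : ℕ} (h : initSeg X τ.length = τ)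
    (hn : τ.length ≤ n) : τ <+: initSeg X n := by
  conv_lhs => rw [← h]
  exact initSeg_prefix X hn

/-! ### Treemaps defined on all strings -/

namespace IsTreemapOn

variable {F : Str → Str} (hF : IsTreemapOn Set.univ F)

include hF

theorem append_prefix (σ : Str) (i : ℕ) : F σ ++ [i] <+: F (σ ++ [i]) := hF σ i trivial

theorem mono {σ σ' : Str} (h : σ <+: σ') : F σ <+: F σ' := by
  obtain ⟨ρ, rfl⟩ := h
  induction ρ using List.reverseRecOn with
  | nil => simp
  | append_singleton ρ i ih =>
    rw [← List.append_assoc]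
    exact ih.trans ((List.prefix_append _ _).trans (hF.append_prefix _ i))

theorem length_le (σ : Str) : σ.length ≤ (F σ).length := by
  induction σ using List.reverseRecOn with
  | nil => simp
  | append_singleton σ i ih =>
    have := (hF.append_prefix σ i).length_le
    simp only [List.length_append, List.length_singleton] at this ⊢
    omega

theorem append_prefix_of_apply {σ σ' : Str} {i : ℕ} (h : F σ ++ [i] <+: F σ') (hσ : σ <+: σ') :
    σ ++ [i] <+: σ' := by
  obtain ⟨_ | ⟨j, ρ⟩, rfl⟩ := hσ
  · simpa using h.length_le
  · have h1 : σ ++ [j] <+: σ ++ j :: ρ := ⟨ρ, by simp⟩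
    have h2 := (hF.append_prefix σ j).trans (hF.mono h1)
    have h3 : F σ ++ [i] = F σ ++ [j] :=
      (List.prefix_of_prefix_length_le h h2 (by simp)).eq_of_length (by simp)
    obtain rfl : i = j := by simpa using h3
    exact h1

theorem prefix_of_apply {σ σ' : Str} (h : F σ <+: F σ') : σ <+: σ' := by
  induction σ using List.reverseRecOn with
  | nil => simp
  | append_singleton σ i ih =>
    have h' := (hF.append_prefix σ i).trans h
    exact hF.append_prefix_of_apply h' (ih ((List.prefix_append _ _).trans h'))

theorem initSeg_pathMap (X : ℕ → ℕ) (n : ℕ) :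
    initSeg (pathMap F X) (F (initSeg X n)).length = F (initSeg X n) := by
  conv_rhs => rw [← initSeg_getD (F (initSeg X n))]
  refine initSeg_eq_initSeg_iff.2 fun j hj => ?_
  have hj' : j < (F (initSeg X (j + 1))).length :=
    lt_of_lt_of_le (by simp) (hF.length_le _)
  rw [pathMap]
  rcases le_total (j + 1) n with h | h
  · obtain ⟨ρ, hρ⟩ := hF.mono (initSeg_prefix X h)
    rw [← hρ, List.getD_append _ _ _ _ hj']
  · obtain ⟨ρ, hρ⟩ := hF.mono (initSeg_prefix X h)
    rw [← hρ, List.getD_append _ _ _ _ hj]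

theorem pathMap_eq_iff {X Y : ℕ → ℕ} :
    pathMap F X = Y ↔ ∀ n, initSeg Y (F (initSeg X n)).length = F (initSeg X n) := by
  constructor
  · rintro rfl n
    exact hF.initSeg_pathMap X n
  · intro h
    funext j
    have hj : j < (F (initSeg X (j + 1))).length := lt_of_lt_of_le (by simp) (hF.length_le _)
    rw [pathMap, ← h, getD_initSeg _ hj]

theorem initSeg_of_pathMap {X : ℕ → ℕ} {σ : Str}
    (h : initSeg (pathMap F X) (F σ).length = F σ) : initSeg X σ.length = σ := by
  have h1 : F σ <+: F (initSeg X (F σ).length) := by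
    conv_rhs => rw [← hF.initSeg_pathMap]
    exact prefix_initSeg h (by simpa using hF.length_le (initSeg X (F σ).length))
  exact initSeg_length_of_prefix (hF.prefix_of_apply h1)

theorem pathMap_length (X : ℕ → ℕ) (n : ℕ) :
    pathMap F X (F (initSeg X n)).length = X n := by
  have h := hF.append_prefix (initSeg X n) (X n)
  rw [← initSeg_succ] at h
  have h1 := initSeg_length_of_prefix (X := pathMap F X) (hF.initSeg_pathMap X (n + 1) ▸ h)
  rw [List.length_append, List.length_singleton, initSeg_succ, hF.initSeg_pathMap] at h1
  simpa using h1

end IsTreemapOn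

theorem eventually_initSeg_eq (X : ℕ → ℕ) (k : ℕ) :
    ∀ᶠ Y in nhds X, initSeg Y k = initSeg X k := by
  simp only [initSeg_eq_initSeg_iff]
  refine (Filter.eventually_all_finite (Set.finite_lt_nat k)).2 fun j _ => ?_
  have h : ContinuousAt (fun Y : ℕ → ℕ => Y j) X := (continuous_apply j).continuousAt
  exact h.eventually (p := fun y => y = X j) (by simp [nhds_discrete])

theorem continuousOn_of_eventually_eq {f : (ℕ → ℕ) → ℕ → ℕ} {P : Set (ℕ → ℕ)}
    (h : ∀ X ∈ P, ∀ n, ∀ᶠ Y in nhdsWithin X P, f Y n = f X n) : ContinuousOn f P :=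
  continuousOn_pi.2 fun n X hX =>
    (continuousWithinAt_const (b := f X n)).congr_of_eventuallyEq (h X hX n) rfl

theorem IsTreemapOn.homeoOn {F : Str → Str} (hF : IsTreemapOn Set.univ F)
    {P Q : Set (ℕ → ℕ)} (hm : Set.MapsTo (pathMap F) P Q) (hs : Set.SurjOn (pathMap F) P Q) :
    HomeoOn (pathMap F) P Q := by
  have hi : Set.InjOn (pathMap F) P := fun X _ X' _ h => by
    funext n
    have h' : initSeg (pathMap F X') (F (initSeg X (n + 1))).length = F (initSeg X (n + 1)) := by
      rw [← h, hF.initSeg_pathMap]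
    have := hF.initSeg_of_pathMap h'
    rw [length_initSeg] at this
    exact (initSeg_eq_initSeg_iff.1 this n (by simp)).symm
  have hb : Set.BijOn (pathMap F) P Q := ⟨hm, hi, hs⟩
  refine ⟨hb, continuousOn_of_eventually_eq fun X _ n => ?_, Function.invFunOn (pathMap F) P,
    hb.invOn_invFunOn, continuousOn_of_eventually_eq fun Z hZ n => ?_⟩
  · filter_upwards [(eventually_initSeg_eq X (n + 1)).filter_mono nhdsWithin_le_nhds] with Y hY
    rw [pathMap, pathMap, hY]
  · set G := Function.invFunOn (pathMap F) P with hG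
    have hr := hb.invOn_invFunOn.2
    filter_upwards [(eventually_initSeg_eq Z (F (initSeg (G Z) (n + 1))).length).filter_mono
      nhdsWithin_le_nhds, self_mem_nhdsWithin] with Z' h1 h2
    have h3 : initSeg (pathMap F (G Z')) (F (initSeg (G Z) (n + 1))).length =
        F (initSeg (G Z) (n + 1)) := by
      rw [hr h2, h1]
      exact hF.pathMap_eq_iff.1 (hr hZ) _
    have h4 := hF.initSeg_of_pathMap h3
    rw [length_initSeg] at h4
    exact initSeg_eq_initSeg_iff.1 h4 n (by simp)

theorem take_prefix_iff {τ τ' : Str} : τ <+: τ' ↔ τ'.take τ.length = τ :=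
  List.prefix_iff_eq_take.trans eq_comm

/-! ### Forcing the jump -/

/-- The initial segment of `Y ⊕ A` that is determined by an initial segment of `Y`. -/
def joinSeg (A : ℕ → ℕ) (τ : Str) : Str :=
  initSeg (oplus (fun j => τ.getD j 0) A) (2 * τ.length)

theorem oplus_congr {X Y A B : ℕ → ℕ} {n : ℕ} (h : ∀ j < n, X j = Y j) (h' : ∀ j < n, A j = B j) :
    initSeg (oplus X A) (2 * n) = initSeg (oplus Y B) (2 * n) := by
  refine initSeg_eq_initSeg_iff.2 fun j hj => ?_
  rw [oplus, oplus, h _ (by omega), h' _ (by omega)]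

theorem joinSeg_eq {A Y : ℕ → ℕ} {τ : Str} (h : initSeg Y τ.length = τ) :
    joinSeg A τ = initSeg (oplus Y A) (2 * τ.length) := by
  refine oplus_congr (fun j hj => ?_) fun _ _ => rfl
  conv_lhs => rw [← h]
  exact getD_initSeg Y hj

/-- An extension of `τ` that decides whether the `n`-th machine with oracle `Y ⊕ A` halts on `n`,
for all `Y` extending it. -/
noncomputable def forceExt (A : ℕ → ℕ) (n : ℕ) (τ : Str) : Str :=
  τ ++ ((decode (sInf {k | sim (joinSeg A (τ ++ (decode k : Option Str).getD [])) n n = true}) :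
    Option Str).getD [])

theorem prefix_forceExt (A : ℕ → ℕ) (n : ℕ) (τ : Str) : τ <+: forceExt A n τ :=
  List.prefix_append _ _

theorem jump_oplus_eq {A Y : ℕ → ℕ} {n : ℕ} {τ : Str}
    (h : initSeg Y (forceExt A n τ).length = forceExt A n τ) :
    jump (oplus Y A) n = cond (sim (joinSeg A (forceExt A n τ)) n n) 1 0 := by
  have hτ : initSeg Y τ.length = τ :=
    initSeg_length_of_prefix (X := Y) (h.symm ▸ prefix_forceExt A n τ)
  have key : (evalo (oplus Y A) (OCode.ofNat n) n).Dom ↔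
      sim (joinSeg A (forceExt A n τ)) n n = true := by
    rw [dom_iff_sim]
    constructor
    · rintro ⟨k, hk⟩
      have h1 : sim (joinSeg A (initSeg Y (max k τ.length))) n n = true := by
        rw [joinSeg_eq (Y := Y) (by rw [length_initSeg]), length_initSeg]
        exact sim_mono (initSeg_prefix _ (by omega)) hk
      obtain ⟨ρ, hρ⟩ := prefix_initSeg hτ (le_max_right k τ.length)
      have h2 : ∃ i, i ∈ {i | sim (joinSeg A (τ ++ (decode i : Option Str).getD [])) n n = true} :=
        ⟨encode ρ, by simpa [hρ] using h1⟩
      exact Nat.sInf_mem h2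
    · intro hs
      exact ⟨_, joinSeg_eq h ▸ hs⟩
  rw [jump]
  by_cases hd : (evalo (oplus Y A) (OCode.ofNat n) n).Dom
  · simp [hd, key.1 hd]
  · rw [if_neg hd, Bool.eq_false_iff.2 fun hs => hd (key.2 hs), cond_false]

/-- The string forced by the first `n` values of `X`, before the `n`-th jump requirement. -/
noncomputable def preSeq (A X : ℕ → ℕ) : ℕ → Str
  | 0 => []
  | n + 1 => forceExt A n (preSeq A X n) ++ [X n]

theorem preSeq_congr {A X Y : ℕ → ℕ} {n : ℕ} (h : ∀ j < n, X j = Y j) :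
    preSeq A X n = preSeq A Y n := by
  induction n with
  | zero => rfl
  | succ n ih => rw [preSeq, preSeq, ih fun j hj => h j (by omega), h n (by omega)]

/-- The string forced by the entries of `σ`. -/
noncomputable def preForce (A : ℕ → ℕ) (σ : Str) : Str :=
  preSeq A (fun j => σ.getD j 0) σ.length

/-- The treemap forcing the jump. -/
noncomputable def force (A : ℕ → ℕ) (σ : Str) : Str := forceExt A σ.length (preForce A σ)

theorem preForce_append (A : ℕ → ℕ) (σ : Str) (i : ℕ) :
    preForce A (σ ++ [i]) = force A σ ++ [i] := by
  rw [preForce, List.length_append, List.length_singleton, preSeq, force, preForce,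
    preSeq_congr (Y := fun j => σ.getD j 0) fun j hj => List.getD_append _ _ _ _ hj]
  simp

theorem preForce_prefix (A : ℕ → ℕ) (σ : Str) : preForce A σ <+: force A σ :=
  prefix_forceExt A _ _

theorem isTreemapOn_force (A : ℕ → ℕ) : IsTreemapOn Set.univ (force A) := fun σ i _ => by
  rw [← preForce_append]
  exact preForce_prefix A _

theorem prefix_of_preForce {A : ℕ → ℕ} {σ σ' : Str} (h : preForce A σ <+: force A σ') :
    σ <+: σ' := by
  have hF := isTreemapOn_force A
  rcases List.eq_nil_or_concat' σ with rfl | ⟨σ, i, rfl⟩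
  · simp
  · rw [preForce_append] at h
    exact hF.append_prefix_of_apply h (hF.prefix_of_apply ((List.prefix_append _ _).trans h))

theorem jump_pathMap_force (A X : ℕ → ℕ) (n : ℕ) :
    jump (oplus (pathMap (force A) X) A) n =
      cond (sim (joinSeg A (force A (initSeg X n))) n n) 1 0 := by
  have h := (isTreemapOn_force A).initSeg_pathMap X n
  rw [force, length_initSeg] at h ⊢
  exact jump_oplus_eq h

/-! ### The image tree -/

/-- A string `τ` is excluded if it is seen to be outside of the image under `force` of the tree
with index `e` relative to the jump of `A`. -/
def excluded (A : ℕ → ℕ) (e : ℕ) : Set Str :=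
  {τ | ∃ σ, preForce A σ <+: τ ∧ (σ ∈ WA (jump A) e ∨ ¬ (τ <+: force A σ ∨ force A σ <+: τ))}

theorem notMem_excluded {A : ℕ → ℕ} {e : ℕ} {σ τ : Str} (hσ : σ ∈ TA (jump A) e)
    (hτ : τ <+: force A σ) : τ ∉ excluded A e := by
  rintro ⟨σ', h, h'⟩
  have hs := prefix_of_preForce (h.trans hτ)
  rcases h' with h' | h'
  · exact hσ _ hs.length_le (by rwa [take_prefix_iff.1 hs])
  · exact h' (List.prefix_or_prefix_of_prefix hτ ((isTreemapOn_force A).mono hs))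

theorem exists_pathMap_force {A Y : ℕ → ℕ} {e : ℕ} (hY : ∀ n, initSeg Y n ∉ excluded A e) :
    ∃ X ∈ PA (jump A) e, pathMap (force A) X = Y := by
  have hF := isTreemapOn_force A
  let s : ℕ → Str := fun n => n.rec [] fun _ σ => σ ++ [Y (force A σ).length]
  let X : ℕ → ℕ := fun n => Y (force A (s n)).length
  have hX (n : ℕ) : s n = initSeg X n := by
    induction n with
    | zero => rfl
    | succ n ih => rw [initSeg_succ, ← ih]
  have hforce {σ : Str} (h : initSeg Y (preForce A σ).length = preForce A σ) :
      initSeg Y (force A σ).length = force A σ := by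
    by_contra hne
    refine hY (force A σ).length ⟨σ, prefix_initSeg h (preForce_prefix A σ).length_le, Or.inr ?_⟩
    rintro (h' | h')
    · exact hne (h'.eq_of_length (by simp))
    · exact hne (h'.eq_of_length (by simp)).symm
  have hpre (n : ℕ) : initSeg Y (preForce A (initSeg X n)).length = preForce A (initSeg X n) := by
    induction n with
    | zero => rfl
    | succ n ih =>
      rw [initSeg_succ, preForce_append, List.length_append, List.length_singleton, initSeg_succ,
        hforce ih, ← hX]
  refine ⟨X, fun n m hm hW => ?_, hF.pathMap_eq_iff.2 fun n => hforce (hpre n)⟩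
  rw [take_initSeg] at hW
  exact hY (preForce A (initSeg X (min m n))).length ⟨_, by rw [hpre], Or.inl hW⟩

/-! ### Moduli for the image tree -/

/-- The approximation of the jump of `A` at stage `s`. -/
def jumpStage (A : ℕ → ℕ) (s q : ℕ) : ℕ := cond (sim (initSeg A s) q q) 1 0

theorem jumpStage_le {A : ℕ → ℕ} {s t : ℕ} (h : s ≤ t) (q : ℕ) :
    jumpStage A s q ≤ jumpStage A t q := by
  rw [jumpStage, jumpStage]
  cases hs : sim (initSeg A s) q q
  · simp
  · rw [sim_mono (initSeg_prefix A h) hs]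

theorem exists_jumpStage_eq (A : ℕ → ℕ) (m : ℕ) :
    ∃ s, ∀ t, s ≤ t → initSeg (jumpStage A t) m = initSeg (jump A) m := by
  have h (q : ℕ) : ∃ s, ∀ t, s ≤ t → jumpStage A t q = jump A q := by
    by_cases hq : (evalo A (OCode.ofNat q) q).Dom
    · obtain ⟨s, hs⟩ := dom_iff_sim.1 hq
      refine ⟨s, fun t ht => ?_⟩
      simp [jumpStage, jump, hq, sim_mono (initSeg_prefix A ht) hs]
    · refine ⟨0, fun t _ => ?_⟩
      have : sim (initSeg A t) q q = false :=
        Bool.eq_false_iff.2 fun hs => hq (dom_iff_sim.2 ⟨t, hs⟩)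
      simp [jumpStage, jump, hq, this]
  choose s hs using h
  refine ⟨(Finset.range m).sup s, fun t ht => initSeg_eq_initSeg_iff.2 fun q hq => ?_⟩
  exact hs q t ((Finset.le_sup (Finset.mem_range.2 hq)).trans ht)

theorem jumpStage_ne_mono {A : ℕ → ℕ} {s t t' m : ℕ} (hs : s ≤ t) (ht : t ≤ t')
    (h : initSeg (jumpStage A t) m ≠ initSeg (jumpStage A s) m) :
    initSeg (jumpStage A t') m ≠ initSeg (jumpStage A s) m := by
  rw [Ne, initSeg_eq_initSeg_iff] at h ⊢
  push Not at h ⊢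
  obtain ⟨q, hq, hne⟩ := h
  have h1 := jumpStage_le (A := A) hs q
  have h2 := jumpStage_le (A := A) ht q
  exact ⟨q, hq, by omega⟩

/-- Coding by its length a triple of an initial segment of `τ`, a use `m` and a stage `s`, the
machine of index `v` does not halt on this initial segment with the oracle approximated at stage
`s`, unless the approximation is seen to change by stage `s + t`. -/
def IsModulus (v : ℕ) (A : ℕ → ℕ) (e : ℕ) (τ : Str) (t : ℕ) : Prop :=
  sim (initSeg (jumpStage A τ.length.unpair.2.unpair.2) τ.length.unpair.2.unpair.1) v
    (encode (e, τ.take τ.length.unpair.1)) = true →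
  initSeg (jumpStage A (τ.length.unpair.2.unpair.2 + t)) τ.length.unpair.2.unpair.1 ≠
    initSeg (jumpStage A τ.length.unpair.2.unpair.2) τ.length.unpair.2.unpair.1

theorem IsModulus.mono {v e t t' : ℕ} {A : ℕ → ℕ} {τ : Str} (h : IsModulus v A e τ t)
    (ht : t ≤ t') : IsModulus v A e τ t' := fun hs =>
  jumpStage_ne_mono (by omega) (by omega) (h hs)

/-- The least modulus. -/
noncomputable def modulus (v : ℕ) (A : ℕ → ℕ) (e : ℕ) (τ : Str) : ℕ :=
  sInf {t | decide (IsModulus v A e τ t) = true}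

/-- The decidable condition stating that `t` is the least modulus. -/
def IsLeastModulus (v : ℕ) (A : ℕ → ℕ) (e : ℕ) (τ : Str) (t : ℕ) : Prop :=
  IsModulus v A e τ t ∧ (t = 0 ∨ ¬ IsModulus v A e τ (t - 1))

theorem isLeastModulus_iff {v e t : ℕ} {A : ℕ → ℕ} {τ : Str} :
    IsLeastModulus v A e τ t ↔ (∃ t, IsModulus v A e τ t) ∧ t = modulus v A e τ := by
  simp only [modulus, decide_eq_true_eq]
  constructor
  · rintro ⟨h, h'⟩
    refine ⟨⟨t, h⟩, le_antisymm ?_ (Nat.sInf_le h)⟩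
    rcases h' with rfl | h'
    · exact Nat.zero_le _
    · by_contra hlt
      have : IsModulus v A e τ (sInf {t | IsModulus v A e τ t}) :=
        Nat.sInf_mem (s := {t | IsModulus v A e τ t}) ⟨t, h⟩
      exact h' (this.mono (by omega))
  · rintro ⟨h, rfl⟩
    refine ⟨Nat.sInf_mem (s := {t | IsModulus v A e τ t}) h,
      (Nat.eq_zero_or_pos _).imp id fun h0 h' => ?_⟩
    have := Nat.sInf_le (s := {t | IsModulus v A e τ t}) h'
    omega

section

variable {v : ℕ} (hv : ∀ A e τ, (evalo (jump A) (OCode.ofNat v) (encode ((e, τ) : ℕ × Str))).Dom ↔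
  τ ∈ excluded A e)

include hv

theorem exists_isModulus {A : ℕ → ℕ} {e : ℕ} {τ : Str}
    (h : ∀ n, τ.take n ∉ excluded A e) : ∃ t, IsModulus v A e τ t := by
  by_contra! hne
  have hs := fun t => Classical.not_imp.1 (hne t)
  obtain ⟨s, hs'⟩ := exists_jumpStage_eq A τ.length.unpair.2.unpair.1
  have h1 := not_not.1 (hs s).2
  rw [hs' _ (by omega)] at h1
  refine h τ.length.unpair.1 ((hv A e _).1 (dom_iff_sim.2 ⟨τ.length.unpair.2.unpair.1, ?_⟩))
  rw [h1]
  exact (hs 0).1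

theorem notMem_excluded_of_isModulus {A Y : ℕ → ℕ} {e : ℕ}
    (h : ∀ j, ∃ t, IsModulus v A e (initSeg Y j) t) (n : ℕ) : initSeg Y n ∉ excluded A e := by
  intro hn
  obtain ⟨m, hm⟩ := dom_iff_sim.1 ((hv A e _).2 hn)
  obtain ⟨s, hs⟩ := exists_jumpStage_eq A m
  obtain ⟨t, ht⟩ := h (Nat.pair n (Nat.pair m s))
  simp only [IsModulus, length_initSeg, Nat.unpair_pair, take_initSeg,
    min_eq_left (Nat.left_le_pair _ _), hs s le_rfl, hs (s + t) (by omega)] at ht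
  exact ht hm rfl

end

/-! ### The treemap -/

/-- The join of `Y` with the sequence of the moduli of its initial segments. -/
noncomputable def withModulus (v : ℕ) (A : ℕ → ℕ) (e : ℕ) (Y : ℕ → ℕ) : ℕ → ℕ :=
  oplus Y fun j => modulus v A e (initSeg Y j)

/-- The treemap onto the tree of index `e` relative to the jump of `A`. -/
noncomputable def jumpMap (v : ℕ) (A : ℕ → ℕ) (e : ℕ) (σ : Str) : Str :=
  initSeg (withModulus v A e fun j => (force A σ).getD j 0) (2 * (force A σ).length)

theorem withModulus_congr {v e n : ℕ} {A X Y : ℕ → ℕ} (h : initSeg X n = initSeg Y n) :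
    initSeg (withModulus v A e X) (2 * n) = initSeg (withModulus v A e Y) (2 * n) := by
  rw [initSeg_eq_initSeg_iff] at h
  refine oplus_congr h fun j hj => ?_
  rw [initSeg_eq_initSeg_iff.2 fun i hi => h i (by omega)]

theorem jumpMap_eq {v e : ℕ} {A Y : ℕ → ℕ} {σ : Str}
    (h : initSeg Y (force A σ).length = force A σ) :
    jumpMap v A e σ = initSeg (withModulus v A e Y) (2 * (force A σ).length) :=
  withModulus_congr (by rw [h, initSeg_getD])

theorem isTreemapOn_jumpMap (v : ℕ) (A : ℕ → ℕ) (e : ℕ) :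
    IsTreemapOn Set.univ (jumpMap v A e) := fun σ i _ => by
  have hF := (isTreemapOn_force A).append_prefix σ i
  set Y : ℕ → ℕ := fun j => (force A (σ ++ [i])).getD j 0
  have h1 : initSeg Y (force A σ).length = force A σ :=
    initSeg_getD_of_prefix ((List.prefix_append _ _).trans hF)
  have h2 : Y (force A σ).length = i := by
    obtain ⟨ρ, hρ⟩ := hF
    simp [Y, ← hρ]
  have h3 : jumpMap v A e σ ++ [i] =
      initSeg (withModulus v A e Y) (2 * (force A σ).length + 1) := by
    rw [initSeg_succ, jumpMap_eq h1]
    simp [withModulus, oplus, h2]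
  rw [h3, jumpMap]
  have := hF.length_le
  simp only [List.length_append, List.length_singleton] at this
  exact initSeg_prefix _ (by omega)

theorem pathMap_jumpMap (v : ℕ) (A : ℕ → ℕ) (e : ℕ) (X : ℕ → ℕ) :
    pathMap (jumpMap v A e) X = withModulus v A e (pathMap (force A) X) := by
  refine (isTreemapOn_jumpMap v A e).pathMap_eq_iff.2 fun n => ?_
  rw [jumpMap_eq ((isTreemapOn_force A).initSeg_pathMap X n), length_initSeg]

/-- The last modulus among the first `n` entries of `Z` is wrong. -/
def HasWrongModulus (v : ℕ) (A : ℕ → ℕ) (e : ℕ) (Z : ℕ → ℕ) (n : ℕ) : Prop :=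
  2 ≤ n ∧ ¬ IsLeastModulus v A e (initSeg (fun q => Z (2 * q)) (n / 2 - 1))
    (Z (2 * (n / 2 - 1) + 1))

theorem hasWrongModulus_congr {v e n : ℕ} {A X Y : ℕ → ℕ} (h : initSeg X n = initSeg Y n) :
    HasWrongModulus v A e X n ↔ HasWrongModulus v A e Y n := by
  rw [initSeg_eq_initSeg_iff] at h
  refine and_congr_right fun hn => ?_
  rw [h _ (by omega), initSeg_eq_initSeg_iff.2 fun q hq => h (2 * q) (by omega)]

section

variable {v i e : ℕ} {A : ℕ → ℕ}
  (hv : ∀ A e τ, (evalo (jump A) (OCode.ofNat v) (encode ((e, τ) : ℕ × Str))).Dom ↔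
    τ ∈ excluded A e)
  (hi : ∀ ρ : Str, ρ ∈ WA A i ↔ HasWrongModulus v A e (fun j => ρ.getD j 0) ρ.length)

include hi

theorem mem_TA_initSeg_iff {Z : ℕ → ℕ} {n : ℕ} :
    initSeg Z n ∈ TA A i ↔ ∀ m ≤ n, ¬ HasWrongModulus v A e Z m := by
  rw [TA, Set.mem_ofPred_eq, length_initSeg]
  refine forall₂_congr fun m hm => not_congr ?_
  rw [take_initSeg, min_eq_left hm, hi, length_initSeg]
  refine hasWrongModulus_congr (initSeg_eq_initSeg_iff.2 fun j hj => getD_initSeg Z hj)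

include hv

theorem jumpMap_mem {σ : Str} (hσ : σ ∈ TA (jump A) e) : jumpMap v A e σ ∈ TA A i := by
  rw [jumpMap, mem_TA_initSeg_iff hi]
  rintro m hm ⟨hm2, h⟩
  refine h (isLeastModulus_iff.2 ⟨exists_isModulus hv fun n => notMem_excluded hσ ?_, ?_⟩)
  · refine (List.take_prefix _ _).trans ?_
    conv_rhs => rw [← initSeg_getD (force A σ)]
    have : (fun q => withModulus v A e (fun j => (force A σ).getD j 0) (2 * q)) =
        fun j => (force A σ).getD j 0 := by
      funext q
      simp [withModulus, oplus]
    rw [this]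
    exact initSeg_prefix _ (by omega)
  · simp [withModulus, oplus, Nat.add_mod, show ∀ k, (2 * k + 1) / 2 = k by omega]

theorem mapsTo_pathMap_jumpMap :
    Set.MapsTo (pathMap (jumpMap v A e)) (PA (jump A) e) (PA A i) := by
  intro X hX n
  have h := jumpMap_mem hv hi (hX n)
  rw [← (isTreemapOn_jumpMap v A e).initSeg_pathMap] at h
  rw [mem_TA_initSeg_iff hi] at h ⊢
  refine fun m hm => h m (hm.trans ?_)
  simpa using (isTreemapOn_jumpMap v A e).length_le (initSeg X n)

theorem surjOn_pathMap_jumpMap :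
    Set.SurjOn (pathMap (jumpMap v A e)) (PA (jump A) e) (PA A i) := by
  intro Z hZ
  have h (j : ℕ) : IsLeastModulus v A e (initSeg (fun q => Z (2 * q)) j) (Z (2 * j + 1)) := by
    have := (mem_TA_initSeg_iff hi).1 (hZ (2 * (j + 1))) _ le_rfl
    rw [HasWrongModulus, not_and, not_not] at this
    simpa using this (by omega)
  obtain ⟨X, hX, hXY⟩ := exists_pathMap_force (A := A) (e := e) (Y := fun q => Z (2 * q))
    (notMem_excluded_of_isModulus hv fun j => (isLeastModulus_iff.1 (h j)).1)
  refine ⟨X, hX, ?_⟩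
  rw [pathMap_jumpMap, hXY]
  funext n
  rw [withModulus, oplus]
  split_ifs with hn
  · congr 1; omega
  · rw [← (isLeastModulus_iff.1 (h (n / 2))).2]
    congr 1; omega

end

/-! ### Uniformly decidable conditions -/

/-- The condition `P i` on the arguments `x i` is decided with oracle `S i`, by a machine that does
not depend on `i`. -/
def UDec {ι α : Type*} [Primcodable α] (S : ι → ℕ → ℕ) (x : ι → α) (P : ι → Prop) : Prop :=
  UComp S x fun i => decide (P i)

namespace UDec

variable {ι α β : Type*} [Primcodable α] [Primcodable β] {S : ι → ℕ → ℕ} {x : ι → α}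
  {P Q : ι → Prop}

theorem congr (h : UDec S x P) (hPQ : ∀ i, P i ↔ Q i) : UDec S x Q :=
  UComp.congr h fun i => by simp [hPQ]

theorem of_bool {b : ι → Bool} (h : UComp S x b) : UDec S x fun i => b i = true :=
  h.congr fun i => by simp

theorem not (h : UDec S x P) : UDec S x fun i => ¬ P i :=
  (h.map Primrec.not.to_comp).congr fun i => by simp

theorem and (h : UDec S x P) (h' : UDec S x Q) : UDec S x fun i => P i ∧ Q i :=
  (h.map₂ h' Primrec.and.to_comp).congr fun i => by simp

theorem or (h : UDec S x P) (h' : UDec S x Q) : UDec S x fun i => P i ∨ Q i :=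
  (h.map₂ h' Primrec.or.to_comp).congr fun i => by simp

theorem imp (h : UDec S x P) (h' : UDec S x Q) : UDec S x fun i => P i → Q i :=
  (h.not.or h').congr fun _ => imp_iff_not_or.symm

theorem eq {y z : ι → β} (h : UComp S x y) (h' : UComp S x z) : UDec S x fun i => y i = z i :=
  (h.map₂ h' Primrec.beq.to_comp).congr fun i => Bool.eq_iff_iff.2 (by simp)

theorem le {y z : ι → ℕ} (h : UComp S x y) (h' : UComp S x z) : UDec S x fun i => y i ≤ z i :=
  (eq (h.map₂ h' Primrec.nat_sub.to_comp) (UComp.of_computable (Computable.const 0))).congr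
    fun _ => Nat.sub_eq_zero_iff_le

theorem isPrefix {y z : ι → Str} (h : UComp S x y) (h' : UComp S x z) :
    UDec S x fun i => y i <+: z i :=
  (eq ((h.map Computable.list_length).map₂ h' Primrec.list_take.to_comp) h).congr
    fun _ => take_prefix_iff.symm

theorem exists_dom_iff {p : ι → ℕ → Prop}
    (hp : UDec (fun q : ι × ℕ => S q.1) (fun q => (x q.1, q.2)) fun q => p q.1 q.2) :
    ∃ v, ∀ i, (evalo (S i) (OCode.ofNat v) (encode (x i))).Dom ↔ ∃ n, p i n := by
  obtain ⟨c, hc⟩ := UComp.exists_dom_iff (p := fun i n => decide (p i n)) hp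
  obtain ⟨v, rfl⟩ := ofNat_surjective c
  exact ⟨v, fun i => by simpa using hc i⟩

end UDec

theorem UComp.sInf {ι α : Type*} [Primcodable α] {S : ι → ℕ → ℕ} {x : ι → α} {p : ι → ℕ → Bool}
    (hp : UComp (fun q : ι × ℕ => S q.1) (fun q => (x q.1, q.2)) fun q => p q.1 q.2) :
    UComp (fun i => jump (S i)) x fun i => sInf {n | p i n = true} := by
  have h1 : UComp (fun q : ι × ℕ => jump (S q.1)) (fun q => (x q.1, q.2))
      fun q => p q.1 q.2 || !decide (∃ n, p q.1 n = true) := by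
    refine (hp.trans_uRed ((URed.jump_self S).reindex Prod.fst)).map₂ ?_ Primrec.or.to_comp
    exact hp.decide_exists.extend.map Primrec.not.to_comp
  refine (h1.sInf_of_exists (p := fun i n => p i n || !decide (∃ n, p i n = true))
    fun i => ?_).congr fun i => ?_
  · by_cases h : ∃ n, p i n = true
    · exact ⟨h.choose, by simp [h.choose_spec]⟩
    · exact ⟨0, by simp [h]⟩
  · by_cases h : ∃ n, p i n = true
    · simp [h]
    · simp [not_exists.1 h]

/-! ### Computability of the forcing treemap -/

theorem uComp_sim {ι α : Type*} [Primcodable α] {S : ι → ℕ → ℕ} {x : ι → α} {L : ι → List ℕ}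
    {e n : ι → ℕ} (hL : UComp S x L) (he : UComp S x e) (hn : UComp S x n) :
    UComp S x fun i => sim (L i) (e i) (n i) :=
  (hL.pair (he.pair hn)).map computable_sim

theorem uComp_getD {ι α : Type*} [Primcodable α] {S : ι → ℕ → ℕ} {x : ι → α} {L : ι → List ℕ}
    {n : ι → ℕ} (hL : UComp S x L) (hn : UComp S x n) : UComp S x fun i => (L i).getD (n i) 0 :=
  hL.map₂ hn (Primrec.list_getD 0).to_comp

theorem uComp_initSeg_getD {ι α : Type*} [Primcodable α] {S : ι → ℕ → ℕ} {x : ι → α}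
    {L : ι → List ℕ} {n : ι → ℕ} (hL : UComp S x L) (hn : UComp S x n) :
    UComp S x fun i => initSeg (fun j => (L i).getD j 0) (n i) :=
  UComp.initSeg (T := fun i j => (L i).getD j 0)
    (uComp_getD hL.extend (UComp.of_computable Computable.snd)) hn

theorem computable_two_mul : Computable fun n : ℕ => 2 * n :=
  (Primrec.nat_mul.comp (Primrec.const 2) Primrec.id).to_comp

theorem uComp_joinSeg {ι α : Type*} [Primcodable α] {S : ι → ℕ → ℕ} {x : ι → α} {τ : ι → Str}
    (h : UComp S x τ) : UComp S x fun i => joinSeg (S i) (τ i) := by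
  refine UComp.initSeg (T := fun i => oplus (fun j => (τ i).getD j 0) (S i)) ?_
    ((h.map Computable.list_length).map computable_two_mul)
  have h1 : UComp (fun q : ι × ℕ => S q.1) (fun q => (x q.1, q.2)) fun q => q.2 / 2 :=
    (UComp.of_computable Computable.snd).map computable_half
  refine UComp.oplus (T := fun q : ι × ℕ => fun j => (τ q.1).getD j 0) ?_ h1.oracle
    (UComp.of_computable Computable.snd)
  exact uComp_getD h.extend h1

theorem computable_getD_decode {α : Type*} [Primcodable α] (a : α) :
    Computable fun n => (decode n : Option α).getD a :=
  (Computable.option_getD Computable.decode (Computable.const a))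

theorem uComp_forceExt {ι α : Type*} [Primcodable α] {A : ι → ℕ → ℕ} {x : ι → α} {n : ι → ℕ}
    {τ : ι → Str} (hn : UComp (fun i => jump (A i)) x n) (hτ : UComp (fun i => jump (A i)) x τ) :
    UComp (fun i => jump (A i)) x fun i => forceExt (A i) (n i) (τ i) := by
  have h1 : UComp (fun q : ((ℕ → ℕ) × ℕ × Str) × ℕ => q.1.1) (fun q => (q.1.2, q.2))
      fun q => q.1.2.1 :=
    UComp.of_computable (Computable.fst.comp Computable.fst)
  have h2 : UComp (fun q : ((ℕ → ℕ) × ℕ × Str) × ℕ => q.1.1) (fun q => (q.1.2, q.2))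
      fun q => q.1.2.2 ++ (decode q.2 : Option Str).getD [] :=
    (UComp.of_computable (Computable.snd.comp Computable.fst)).map₂
      (UComp.of_computable ((computable_getD_decode []).comp Computable.snd))
      Computable.list_append
  have h3 := UComp.sInf (S := fun p : (ℕ → ℕ) × ℕ × Str => p.1) (x := fun p => p.2)
    (p := fun p k => sim (joinSeg p.1 (p.2.2 ++ (decode k : Option Str).getD [])) p.2.1 p.2.1)
    (uComp_sim (uComp_joinSeg h2) h1 h1)
  exact hτ.map₂ (((hn.pair hτ).trans (h3.reindex fun i => (A i, n i, τ i))).map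
    (computable_getD_decode [])) Computable.list_append

theorem uComp_preForce {ι α : Type*} [Primcodable α] {A : ι → ℕ → ℕ} {x : ι → α} {σ : ι → Str}
    (h : UComp (fun i => jump (A i)) x σ) :
    UComp (fun i => jump (A i)) x fun i => preForce (A i) (σ i) := by
  have h1 := UComp.nat_rec (S := fun i => jump (A i)) (x := σ)
    (f := fun i => preSeq (A i) fun j => (σ i).getD j 0)
    (UComp.of_computable (Computable.const ([] : Str))) <| by
      have h2 : UComp (fun p : ι × ℕ => jump (A p.1))
          (fun p => (σ p.1, p.2, preSeq (A p.1) (fun j => (σ p.1).getD j 0) p.2)) fun p => p.2 :=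
        UComp.of_computable (Computable.fst.comp Computable.snd)
      exact (uComp_forceExt h2 (UComp.of_computable (Computable.snd.comp Computable.snd))).map₂
        (uComp_getD (UComp.of_computable Computable.fst) h2) Computable.list_concat
  exact (h.pair (h.map Computable.list_length)).trans (h1.reindex fun i => (i, (σ i).length))

theorem uComp_force {ι α : Type*} [Primcodable α] {A : ι → ℕ → ℕ} {x : ι → α} {σ : ι → Str}
    (h : UComp (fun i => jump (A i)) x σ) :
    UComp (fun i => jump (A i)) x fun i => force (A i) (σ i) :=
  uComp_forceExt (h.map Computable.list_length) (uComp_preForce h)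

/-! ### Computability of the image tree -/

theorem exists_dom_iff_mem_excluded : ∃ v, ∀ A e τ,
    (evalo (jump A) (OCode.ofNat v) (encode ((e, τ) : ℕ × Str))).Dom ↔ τ ∈ excluded A e := by
  let s : ℕ → Str × ℕ := fun k => (decode k : Option (Str × ℕ)).getD ([], 0)
  let p : (ℕ → ℕ) × ℕ × Str → ℕ → Prop := fun q k =>
    preForce q.1 (s k).1 <+: q.2.2 ∧
      (sim (initSeg (jump q.1) (s k).2) q.2.1 (encode (s k).1) = true ∨
        ¬ (q.2.2 <+: force q.1 (s k).1 ∨ force q.1 (s k).1 <+: q.2.2))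
  have hp : UDec (fun q : ((ℕ → ℕ) × ℕ × Str) × ℕ => jump q.1.1) (fun q => (q.1.2, q.2))
      fun q => p q.1 q.2 := by
    have h1 : UComp (fun q : ((ℕ → ℕ) × ℕ × Str) × ℕ => jump q.1.1) (fun q => (q.1.2, q.2))
        fun q => s q.2 :=
      UComp.of_computable ((computable_getD_decode _).comp Computable.snd)
    have h2 : UComp (fun q : ((ℕ → ℕ) × ℕ × Str) × ℕ => jump q.1.1) (fun q => (q.1.2, q.2))
        fun q => q.1.2.2 :=
      UComp.of_computable (Computable.snd.comp Computable.fst)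
    have h3 := h1.map Computable.fst
    refine (UDec.isPrefix (uComp_preForce h3) h2).and (.or (.of_bool (uComp_sim ?_
      (UComp.of_computable (Computable.fst.comp Computable.fst)) (h3.map Computable.encode))) ?_)
    · exact UComp.initSeg (UComp.of_computable Computable.snd).oracle (h1.map Computable.snd)
    · exact ((UDec.isPrefix h2 (uComp_force h3)).or (UDec.isPrefix (uComp_force h3) h2)).not
  obtain ⟨v, hv⟩ := UDec.exists_dom_iff (S := fun q : (ℕ → ℕ) × ℕ × Str => jump q.1)
    (x := fun q => q.2) hp
  refine ⟨v, fun A e τ => (hv (A, e, τ)).trans ?_⟩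
  simp only [p, excluded, WA, Set.mem_ofPred_eq, dom_iff_sim]
  constructor
  · rintro ⟨k, h, h'⟩
    exact ⟨_, h, h'.imp (fun h => ⟨_, h⟩) id⟩
  · rintro ⟨σ, h, ⟨m, hm⟩ | h'⟩
    · exact ⟨encode (σ, m), by simpa [s] using ⟨h, Or.inl hm⟩⟩
    · exact ⟨encode (σ, 0), by simpa [s] using ⟨h, Or.inr (not_or.1 h')⟩⟩

section

variable {ι α : Type*} [Primcodable α] {A : ι → ℕ → ℕ} {x : ι → α} {e t : ι → ℕ} {τ : ι → Str}

theorem uComp_initSeg_jumpStage {s m : ι → ℕ} (hs : UComp A x s) (hm : UComp A x m) :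
    UComp A x fun i => initSeg (jumpStage (A i) (s i)) (m i) := by
  refine UComp.initSeg ?_ hm
  have h1 : UComp (fun q : ι × ℕ => A q.1) (fun q => (x q.1, q.2)) fun q => q.2 :=
    UComp.of_computable Computable.snd
  have h2 : UComp (fun q : ι × ℕ => A q.1) (fun q => (x q.1, q.2)) fun q => s q.1 :=
    hs.extend
  refine (uComp_sim (UComp.initSeg (UComp.of_computable Computable.snd).oracle h2) h1 h1).map
    (f := fun b => cond b 1 0) ?_
  exact Computable.cond Computable.id (Computable.const 1) (Computable.const 0)

theorem uDec_isModulus (v : ℕ) (he : UComp A x e) (hτ : UComp A x τ) (ht : UComp A x t) :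
    UDec A x fun i => IsModulus v (A i) (e i) (τ i) (t i) := by
  have hl := hτ.map Computable.list_length
  have h0 := hl.map (Computable.fst.comp Primrec.unpair.to_comp)
  have h12 := hl.map (Computable.snd.comp Primrec.unpair.to_comp)
  have h1 := h12.map (Computable.fst.comp Primrec.unpair.to_comp)
  have h2 := h12.map (Computable.snd.comp Primrec.unpair.to_comp)
  have h3 := uComp_initSeg_jumpStage h2 h1
  refine .imp (.of_bool (uComp_sim h3 (UComp.of_computable (Computable.const v)) ?_)) (.not ?_)
  · exact (he.pair (h0.map₂ hτ Primrec.list_take.to_comp)).map Computable.encode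
  · exact .eq (uComp_initSeg_jumpStage (h2.map₂ ht Primrec.nat_add.to_comp) h1) h3

theorem uDec_isLeastModulus (v : ℕ) (he : UComp A x e) (hτ : UComp A x τ) (ht : UComp A x t) :
    UDec A x fun i => IsLeastModulus v (A i) (e i) (τ i) (t i) :=
  (uDec_isModulus v he hτ ht).and ((UDec.eq ht (UComp.of_computable (Computable.const 0))).or
    (uDec_isModulus v he hτ (ht.map Computable.pred)).not)

theorem uDec_hasWrongModulus (v : ℕ) (he : UComp A x e) (hτ : UComp A x τ) :
    UDec A x fun i => HasWrongModulus v (A i) (e i) (fun j => (τ i).getD j 0) (τ i).length := by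
  have hl := hτ.map Computable.list_length
  have h1 : UComp A x fun i => (τ i).length / 2 - 1 :=
    (hl.map computable_half).map Computable.pred
  have h2 := h1.map computable_two_mul
  refine (UDec.le (UComp.of_computable (Computable.const 2)) hl).and
    (.not (uDec_isLeastModulus v he (UComp.initSeg ?_ h1)
      (uComp_getD hτ (h2.map Computable.succ))))
  exact uComp_getD hτ.extend (UComp.of_computable (computable_two_mul.comp Computable.snd))

theorem uComp_modulus (v : ℕ) (he : UComp (fun i => jump (A i)) x e)
    (hτ : UComp (fun i => jump (A i)) x τ) :
    UComp (fun i => jump (A i)) x fun i => modulus v (A i) (e i) (τ i) := by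
  refine (he.pair hτ).trans (UComp.sInf (p := fun i t => decide (IsModulus v (A i) (e i) (τ i) t))
    (uDec_isModulus v ?_ ?_ (UComp.of_computable Computable.snd)))
  · exact UComp.of_computable (Computable.fst.comp Computable.fst)
  · exact UComp.of_computable (Computable.snd.comp Computable.fst)

theorem uComp_modulus_of_exists (v : ℕ) {S : ι → ℕ → ℕ} (hS : URed S A) (he : UComp S x e)
    (hτ : UComp S x τ) (h : ∀ i, ∃ t, IsModulus v (A i) (e i) (τ i) t) :
    UComp S x fun i => modulus v (A i) (e i) (τ i) := by
  refine (he.pair hτ).trans ((UComp.sInf_of_exists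
    (p := fun i t => decide (IsModulus v (A i) (e i) (τ i) t))
    (uDec_isModulus v ?_ ?_ (UComp.of_computable Computable.snd)) ?_).trans_uRed hS)
  · exact UComp.of_computable (Computable.fst.comp Computable.fst)
  · exact UComp.of_computable (Computable.snd.comp Computable.fst)
  · simpa using h

theorem uComp_jumpMap (v : ℕ) {σ : ι → Str} (he : UComp (fun i => jump (A i)) x e)
    (hσ : UComp (fun i => jump (A i)) x σ) :
    UComp (fun i => jump (A i)) x fun i => jumpMap v (A i) (e i) (σ i) := by
  have h1 := uComp_force hσ
  refine UComp.initSeg (T := fun i => withModulus v (A i) (e i) fun j =>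
    (force (A i) (σ i)).getD j 0) ?_ ((h1.map Computable.list_length).map computable_two_mul)
  have h2 : UComp (fun q : ι × ℕ => jump (A q.1)) (fun q => (x q.1, q.2)) fun q => q.2 / 2 :=
    (UComp.of_computable Computable.snd).map computable_half
  exact UComp.oplus (T := fun q : ι × ℕ => fun j => (force (A q.1) (σ q.1)).getD j 0)
    (U := fun q : ι × ℕ => fun j => modulus v (A q.1) (e q.1)
      (initSeg (fun j => (force (A q.1) (σ q.1)).getD j 0) j))
    (uComp_getD h1.extend h2) (uComp_modulus v he.extend (uComp_initSeg_getD h1.extend h2))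
    (UComp.of_computable Computable.snd)

end

/-! ### Jump inversion -/

theorem uRed_pathMap {ι : Type*} {S X : ι → ℕ → ℕ} {F : ι → Str → Str}
    (hF : UComp (fun p : ι × Str => S p.1) (fun p => p.2) fun p => F p.1 p.2) (hX : URed S X) :
    URed S fun i => pathMap (F i) (X i) := by
  refine URed.iff_uComp.2 ?_
  have h : UComp (fun p : ι × ℕ => S p.1) (fun p => p.2) fun p => initSeg (X p.1) (p.2 + 1) :=
    UComp.initSeg ((hX.reindex fun p : (ι × ℕ) × ℕ => p.1.1).uComp
      (UComp.of_computable Computable.snd)) (UComp.of_computable Computable.succ)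
  exact uComp_getD (h.trans (hF.reindex fun p : ι × ℕ => (p.1, initSeg (X p.1) (p.2 + 1))))
    (UComp.of_computable Computable.id)

theorem uRed_of_pathMap {ι : Type*} {S X : ι → ℕ → ℕ} {F : ι → Str → Str}
    (hF : UComp (fun p : ι × Str => S p.1) (fun p => p.2) fun p => F p.1 p.2)
    (htree : ∀ i, IsTreemapOn Set.univ (F i)) (hZ : URed S fun i => pathMap (F i) (X i)) :
    URed S X := by
  have h : UComp (fun p : ι × ℕ => S p.1) (fun p => ((), p.2)) fun p => initSeg (X p.1) p.2 := by
    refine UComp.nat_rec (x := fun _ => ()) (f := fun i => initSeg (X i))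
      (UComp.of_computable (Computable.const ([] : Str))) ?_
    have h1 : UComp (fun p : ι × ℕ => S p.1) (fun p => ((), p.2, initSeg (X p.1) p.2))
        fun p => initSeg (X p.1) p.2 :=
      UComp.of_computable (Computable.snd.comp Computable.snd)
    have h2 := (hZ.reindex (Prod.fst : ι × ℕ → ι)).uComp ((h1.trans (hF.reindex
      fun p : ι × ℕ => (p.1, initSeg (X p.1) p.2))).map Computable.list_length)
    refine (h1.map₂ h2 Computable.list_concat).congr fun p => ?_
    rw [initSeg_succ, (htree p.1).pathMap_length]
  have h1 : UComp (fun p : ι × ℕ => S p.1) (fun p => p.2) fun p => ((), p.2 + 1) :=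
    UComp.of_computable ((Computable.const ()).pair Computable.succ)
  refine URed.iff_uComp.2 ((uComp_getD (h1.trans (h.reindex fun p : ι × ℕ => (p.1, p.2 + 1)))
    (UComp.of_computable Computable.id)).congr fun p => ?_)
  exact getD_initSeg _ (Nat.lt_succ_self _)

theorem uRed_withModulus {ι : Type*} (v : ℕ) (A : ℕ → ℕ) (e : ℕ) {Y : ι → ℕ → ℕ}
    (h : ∀ i j, ∃ t, IsModulus v A e (initSeg (Y i) j) t) :
    URed (fun i => oplus (Y i) A) fun i => withModulus v A e (Y i) := by
  have hY := URed.left_oplus Y fun _ => A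
  refine hY.oplus (URed.iff_uComp.2 ?_)
  refine uComp_modulus_of_exists v ((URed.right_oplus Y fun _ => A).reindex Prod.fst)
    (UComp.of_computable (Computable.const e))
    (UComp.initSeg ?_ (UComp.of_computable Computable.id)) fun p => h p.1 p.2
  exact (hY.reindex fun p : (ι × ℕ) × ℕ => p.1.1).uComp (UComp.of_computable Computable.snd)

theorem uRed_jump_pathMap_force {ι : Type*} (A : ℕ → ℕ) (X : ι → ℕ → ℕ) :
    URed (fun i => oplus (X i) (jump A)) fun i => jump (oplus (pathMap (force A) (X i)) A) := by
  refine URed.iff_uComp.2 ?_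
  have hn : UComp (fun p : ι × ℕ => oplus (X p.1) (jump A)) (fun p => p.2) fun p => p.2 :=
    UComp.of_computable Computable.id
  have hX : UComp (fun p : ι × ℕ => oplus (X p.1) (jump A)) (fun p => p.2)
      fun p => initSeg (X p.1) p.2 :=
    UComp.initSeg (((URed.left_oplus X fun _ => jump A).reindex
      fun p : (ι × ℕ) × ℕ => p.1.1).uComp (UComp.of_computable Computable.snd)) hn
  have hJ : URed (fun p : ι × ℕ => oplus (X p.1) (jump A)) fun _ => jump A :=
    (URed.right_oplus X fun _ => jump A).reindex Prod.fst
  have hF : UComp (fun _ : ι × ℕ => jump A) (fun p => initSeg (X p.1) p.2)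
      fun p => force A (initSeg (X p.1) p.2) :=
    uComp_force (UComp.of_computable Computable.id)
  have hL : UComp (fun _ : ι × ℕ => jump A) (fun p => force A (initSeg (X p.1) p.2))
      fun p => joinSeg A (force A (initSeg (X p.1) p.2)) :=
    (uComp_joinSeg (UComp.of_computable Computable.id)).trans_uRed (URed.jump_self fun _ => A)
  refine (UComp.map (f := fun b => cond b 1 0)
    (uComp_sim (hX.trans ((hF.trans hL).trans_uRed hJ)) hn hn) ?_).congr
    fun p => (jump_pathMap_force A (X p.1) p.2).symm
  exact Computable.cond Computable.id (Computable.const 1) (Computable.const 0)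

theorem URed.unifEquivOn {P : Set (ℕ → ℕ)} {f g : (ℕ → ℕ) → ℕ → ℕ}
    (h : URed (fun X : P => f X) fun X => g X) (h' : URed (fun X : P => g X) fun X => f X) :
    UnifEquivOn P f g := by
  obtain ⟨c, hc⟩ := h
  obtain ⟨d, hd⟩ := h'
  exact ⟨d, c, fun X hX => ⟨hd ⟨X, hX⟩, hc ⟨X, hX⟩⟩⟩

theorem exists_primrec_mem_WA_iff (v : ℕ) : ∃ h : ℕ → ℕ, Nat.Primrec h ∧ ∀ A e (ρ : Str),
    ρ ∈ WA A (h e) ↔ HasWrongModulus v A e (fun j => ρ.getD j 0) ρ.length := by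
  obtain ⟨w, hw⟩ := UDec.exists_dom_iff (S := fun p : (ℕ → ℕ) × ℕ × Str => p.1)
    (x := fun p => p.2)
    (p := fun p _ => HasWrongModulus v p.1 p.2.1 (fun j => p.2.2.getD j 0) p.2.2.length)
    (uDec_hasWrongModulus v (UComp.of_computable (Computable.fst.comp Computable.fst))
      (UComp.of_computable (Computable.snd.comp Computable.fst)))
  obtain ⟨h, hh, hc⟩ := exists_primrec_curry (OCode.ofNat w)
  refine ⟨h, hh, fun A e ρ => ?_⟩
  rw [WA, Set.mem_ofPred_eq, hc]
  exact (hw (A, e, ρ)).trans (by simp)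

theorem exists_primrec_evalo_jumpMap (v : ℕ) : ∃ g : ℕ → ℕ, Nat.Primrec g ∧ ∀ A e (σ : Str),
    evalo (jump A) (OCode.ofNat (g e)) (encode σ) = Part.some (encode (jumpMap v A e σ)) := by
  obtain ⟨c, hc⟩ : UComp (fun p : (ℕ → ℕ) × ℕ × Str => jump p.1) (fun p => p.2)
      fun p => jumpMap v p.1 p.2.1 p.2.2 :=
    uComp_jumpMap v (UComp.of_computable Computable.fst) (UComp.of_computable Computable.snd)
  obtain ⟨g, hg, hgc⟩ := exists_primrec_curry c
  exact ⟨g, hg, fun A e σ => (hgc _ _ _).trans (hc (A, e, σ))⟩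

end

/-- **Refined Lemma.**  There is a primitive recursive `h` such that, effectively in
`e` (via a primitive recursive index function `g` for the `A'`-recursive code of `H`),
one finds an `A'`-recursive treemap `H : T_e^{A'} → T_{h(e)}^A` inducing a
homeomorphism of `P_e^{A'}` onto `P_{h(e)}^A` with
`X ⊕ A' ≡_T H(X) ⊕ A' ≡_T (H(X) ⊕ A)'` uniformly for all `X ∈ P_e^{A'}`. -/
theorem refined_pi01_jump_inversion :
    ∃ h : ℕ → ℕ, Nat.Primrec h ∧ ∃ g : ℕ → ℕ, Nat.Primrec g ∧
      ∀ (A : ℕ → ℕ) (e : ℕ), ∃ H : Str → Str,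
        IsTreemapOn (TA (jump A) e) H ∧
        (∀ σ ∈ TA (jump A) e, H σ ∈ TA A (h e)) ∧
        (∀ σ ∈ TA (jump A) e,
          evalo (jump A) (OCode.ofNat (g e)) (Encodable.encode σ) =
            Part.some (Encodable.encode (H σ))) ∧
        HomeoOn (pathMap H) (PA (jump A) e) (PA A (h e)) ∧
        UnifEquivOn (PA (jump A) e) (fun X => oplus X (jump A))
          (fun X => oplus (pathMap H X) (jump A)) ∧
        UnifEquivOn (PA (jump A) e) (fun X => oplus (pathMap H X) (jump A))
          (fun X => jump (oplus (pathMap H X) A)) := by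
  obtain ⟨v, hv⟩ := exists_dom_iff_mem_excluded
  obtain ⟨h, hh, hi⟩ := exists_primrec_mem_WA_iff v
  obtain ⟨g, hg, hgc⟩ := exists_primrec_evalo_jumpMap v
  refine ⟨h, hh, g, hg, fun A e => ⟨jumpMap v A e,
    fun σ i _ => isTreemapOn_jumpMap v A e σ i trivial,
    fun σ => jumpMap_mem hv (hi A e), fun σ _ => hgc A e σ,
    (isTreemapOn_jumpMap v A e).homeoOn (mapsTo_pathMap_jumpMap hv (hi A e))
      (surjOn_pathMap_jumpMap hv (hi A e)), ?_⟩⟩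
  let J : PA (jump A) e → ℕ → ℕ := fun _ => jump A
  let Z : PA (jump A) e → ℕ → ℕ := fun X => pathMap (jumpMap v A e) X
  have hmap {S : PA (jump A) e → ℕ → ℕ} (hS : URed S J) :
      UComp (fun p : PA (jump A) e × Str => S p.1) (fun p => p.2) fun p => jumpMap v A e p.2 :=
    (uComp_jumpMap v (UComp.of_computable (Computable.const e))
      (UComp.of_computable Computable.id)).trans_uRed (hS.reindex Prod.fst)
  have hXJ := URed.right_oplus (fun X : PA (jump A) e => X.1) J
  have hZJ := URed.right_oplus Z J
  have h1 : URed (fun X : PA (jump A) e => oplus X.1 (jump A)) Z :=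
    uRed_pathMap (hmap hXJ) (URed.left_oplus _ J)
  have h2 : URed (fun X => oplus (Z X) (jump A)) fun X => X.1 :=
    uRed_of_pathMap (hmap hZJ) (fun _ => isTreemapOn_jumpMap v A e) (URed.left_oplus _ J)
  have h3 : URed (fun X => jump (oplus (Z X) A)) fun X => oplus (Z X) (jump A) :=
    ((URed.jump_self _).trans (URed.left_oplus Z fun _ => A)).oplus
      (URed.right_oplus Z fun _ => A).jump_mono
  have h4 : URed (fun X : PA (jump A) e => oplus (pathMap (force A) X) A) Z := by
    simp only [Z, pathMap_jumpMap]
    refine uRed_withModulus v A e fun X j => exists_isModulus hv fun n => ?_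
    refine notMem_excluded (X.2 j) ((List.take_prefix _ _).trans ?_)
    rw [← (isTreemapOn_force A).initSeg_pathMap]
    refine OCode.initSeg_prefix _ ?_
    simpa using (isTreemapOn_force A).length_le (initSeg X.1 j)
  have h5 : URed (fun X : PA (jump A) e => oplus X.1 (jump A)) fun X => jump (oplus (Z X) A) :=
    (uRed_jump_pathMap_force A _).trans (h4.oplus (URed.right_oplus _ fun _ => A)).jump_mono
  exact ⟨(h1.oplus hXJ).unifEquivOn (h2.oplus hZJ), ((h2.oplus hZJ).trans h5).unifEquivOn h3⟩

end Harrington
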